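/- arXiv:1608.02155 — 3 statements merged into one kernel-verified Lean document; each statement's English description precedes it below -/
import Mathlib

section
/- Let φ ∈ K(z) have degree d ≥ 2 and suppose φ has semistable reduction. If for some n ≥ 1 the minimal resultant satisfies R_{[φⁿ]} = N_n · R_{[φ]}, where N_n = dⁿ(dⁿ−1)/(d(d−1)), then φⁿ also has semistable reduction (in the same coordinates). -/
open MvPolynomial Matrix

noncomputable section

variable {R : Type*} [CommRing R]

def coeffVec (e : ℕ) (F : MvPolynomial (Fin 2) R) (i : Fin (e + 1)) : R :=
  MvPolynomial.coeff (Finsupp.single 0 (e - (i : ℕ)) + Finsupp.single 1 (i : ℕ)) F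

def sylv (e : ℕ) (a b : Fin (e + 1) → R) : Matrix (Fin (e + e)) (Fin (e + e)) R :=
  Matrix.of fun i j =>
    if h : (i : ℕ) < e then
      if hj : (i : ℕ) ≤ (j : ℕ) ∧ (j : ℕ) ≤ (i : ℕ) + e then
        a ⟨(j : ℕ) - (i : ℕ), by omega⟩ else 0
    else
      if hj : (i : ℕ) - e ≤ (j : ℕ) ∧ (j : ℕ) ≤ (i : ℕ) then
        b ⟨(j : ℕ) - ((i : ℕ) - e), by omega⟩ else 0

def bres (e : ℕ) (F G : MvPolynomial (Fin 2) R) : R :=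
  (sylv e (coeffVec e F) (coeffVec e G)).det

def comp2 (F f g : MvPolynomial (Fin 2) R) : MvPolynomial (Fin 2) R :=
  MvPolynomial.aeval ![f, g] F

def pairIter (F G : MvPolynomial (Fin 2) R) : ℕ → MvPolynomial (Fin 2) R × MvPolynomial (Fin 2) R
  | 0 => (X 0, X 1)
  | n + 1 => (comp2 F (pairIter F G n).1 (pairIter F G n).2,
              comp2 G (pairIter F G n).1 (pairIter F G n).2)

variable (K : Type) [NontriviallyNormedField K] [IsUltrametricDist K]

def ordv (x : K) : ℝ := -Real.log ‖x‖

def intRing : Subring K where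
  carrier := {x : K | ‖x‖ ≤ 1}
  one_mem' := by simp
  zero_mem' := by simp
  mul_mem' := by
    intro a b ha hb
    simp only [Set.mem_setOf_eq] at *
    calc ‖a * b‖ = ‖a‖ * ‖b‖ := norm_mul a b
    _ ≤ 1 * 1 := by gcongr
    _ = 1 := by ring
  add_mem' := by
    intro a b ha hb
    simp only [Set.mem_setOf_eq] at *
    exact (IsUltrametricDist.norm_add_le_max a b).trans (max_le ha hb)
  neg_mem' := by
    intro a ha
    simp only [Set.mem_setOf_eq, norm_neg] at *
    exact ha

def maxIdl : Ideal (intRing K) where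
  carrier := {x | ‖(x : K)‖ < 1}
  zero_mem' := by simp
  add_mem' := by
    intro a b ha hb
    simp only [Set.mem_setOf_eq] at *
    exact lt_of_le_of_lt (IsUltrametricDist.norm_add_le_max (a : K) b) (max_lt ha hb)
  smul_mem' := by
    intro c x hx
    simp only [Set.mem_setOf_eq] at *
    calc ‖((c • x : intRing K) : K)‖ = ‖(c : K)‖ * ‖(x : K)‖ := norm_mul _ _
    _ ≤ 1 * ‖(x : K)‖ := by gcongr; exact c.2
    _ < 1 := by simpa using hx

def kk := intRing K ⧸ maxIdl K

instance : CommRing (kk K) := Ideal.Quotient.commRing (maxIdl K)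

def redCoeff (x : K) : kk K :=
  if h : ‖x‖ ≤ 1 then Ideal.Quotient.mk (maxIdl K) ⟨x, h⟩ else 0

def redPoly (F : MvPolynomial (Fin 2) K) : MvPolynomial (Fin 2) (kk K) :=
  ∑ m ∈ F.support, MvPolynomial.monomial m (redCoeff K (F.coeff m))

/-- A pair of binary forms is a (homogeneous) lift of a degree-`d` rational map if both entries
are homogeneous of degree `d` and they are coprime. -/
def LiftPair (d : ℕ) (F G : MvPolynomial (Fin 2) K) : Prop :=
  F.IsHomogeneous d ∧ G.IsHomogeneous d ∧ IsRelPrime F G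

/-- A pair of binary forms is normalized if all coefficients lie in `O`
and some coefficient has absolute value `1`. -/
def Normalized (F G : MvPolynomial (Fin 2) K) : Prop :=
  (∀ m, ‖F.coeff m‖ ≤ 1) ∧ (∀ m, ‖G.coeff m‖ ≤ 1) ∧
    (∃ m, ‖F.coeff m‖ = 1 ∨ ‖G.coeff m‖ = 1)

/-- The maximum of the absolute values of the coefficients of a pair of degree-`e` binary forms. -/
def maxNorm (e : ℕ) (F G : MvPolynomial (Fin 2) K) : ℝ :=
  Finset.univ.sup' Finset.univ_nonempty
    (fun i : Fin (e + 1) => max ‖coeffVec e F i‖ ‖coeffVec e G i‖)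

/-- `Rpair e F G` is the quantity `R_φ = ord(Res(F₀,G₀))` where `(F₀,G₀)` is the normalized
rescaling of the pair `(F,G)` of degree-`e` binary forms; equivalently it is
`ord(Res(F,G)) - 2·e·(minimal ord of a coefficient of F, G)`. -/
def Rpair (e : ℕ) (F G : MvPolynomial (Fin 2) K) : ℝ :=
  ordv K (bres e F G) + 2 * e * Real.log (maxNorm K e F G)

/-- Linear substitution of a `2×2` matrix into a binary form. -/
def mobius (M : Matrix (Fin 2) (Fin 2) K) (F : MvPolynomial (Fin 2) K) :
    MvPolynomial (Fin 2) K :=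
  MvPolynomial.aeval
    ![C (M 0 0) * X 0 + C (M 0 1) * X 1, C (M 1 0) * X 0 + C (M 1 1) * X 1] F

/-- The conjugate pair `γ⁻¹ ∘ (F,G) ∘ γ`, a homogeneous lift of `φ^γ = γ⁻¹ ∘ φ ∘ γ`. -/
def conjPair (M : GL (Fin 2) K) (F G : MvPolynomial (Fin 2) K) :
    MvPolynomial (Fin 2) K × MvPolynomial (Fin 2) K :=
  (C ((M⁻¹ : GL (Fin 2) K) 0 0) * mobius K M F + C ((M⁻¹ : GL (Fin 2) K) 0 1) * mobius K M G,
   C ((M⁻¹ : GL (Fin 2) K) 1 0) * mobius K M F + C ((M⁻¹ : GL (Fin 2) K) 1 1) * mobius K M G)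

/-- The minimal resultant `R_{[φ]} = inf_γ R_{φ^γ}` of (the map lifted by) a degree-`e` pair. -/
def Rmin (e : ℕ) (F G : MvPolynomial (Fin 2) K) : ℝ :=
  ⨅ M : GL (Fin 2) K, Rpair K e (conjPair K M F G).1 (conjPair K M F G).2

/-- `Ilocus d F G` says the reduction of the normalized pair `(F,G)` lies in the indeterminacy
locus `I(d)`: the reduced pair is proportional, i.e. `(F̃, G̃) = (a·C, b·C)` with `[a:b] ∈ P¹(k)`
(so that the residue map is the constant `[a:b]`), and the constant value `[a:b]`
is a root of the common factor `C` (which is the gcd `Ã` of `F̃` and `G̃`). -/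
def Ilocus (d : ℕ) (F G : MvPolynomial (Fin 2) K) : Prop :=
  ∃ (a b : kk K) (Cf : MvPolynomial (Fin 2) (kk K)),
    ¬(a = 0 ∧ b = 0) ∧ Cf.IsHomogeneous d ∧
    redPoly K F = MvPolynomial.C a * Cf ∧ redPoly K G = MvPolynomial.C b * Cf ∧
    MvPolynomial.eval ![a, b] Cf = 0

/-- `Semistable d F G` says the reduction of the normalized pair `(F,G)` is GIT-semistable
(Silverman's numerical criterion): writing `F̃ = Ã·F̃₀`, `G̃ = Ã·G̃₀` with `F̃₀, G̃₀` coprime,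
every root `h = [a:b]` of `Ã` has multiplicity `r ≤ d/2` (`d` even), resp. `r ≤ (d+1)/2`
(`d` odd), and when the bound is attained additionally `φ̃(h) ≠ h`. -/
def Semistable (d : ℕ) (F G : MvPolynomial (Fin 2) K) : Prop :=
  ∃ (A F0 G0 : MvPolynomial (Fin 2) (kk K)) (e : ℕ),
    e ≤ d ∧ A.IsHomogeneous (d - e) ∧ F0.IsHomogeneous e ∧ G0.IsHomogeneous e ∧
    redPoly K F = A * F0 ∧ redPoly K G = A * G0 ∧ IsRelPrime F0 G0 ∧
    ∀ (a b : kk K), ¬(a = 0 ∧ b = 0) → ∀ r : ℕ,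
      (MvPolynomial.C b * X 0 - MvPolynomial.C a * X 1) ^ r ∣ A →
        2 * r ≤ d + 1 ∧
          (d ≤ 2 * r →
            b * MvPolynomial.eval ![a, b] F0 ≠ a * MvPolynomial.eval ![a, b] G0)

/-- The rational map lifted by the (not necessarily normalized) pair `(F,G)` has semistable
reduction: some normalized rescaling is `Semistable`. -/
def HasSemistableRed (d : ℕ) (F G : MvPolynomial (Fin 2) K) : Prop :=
  ∃ c : Kˣ, Normalized K ((c : K) • F) ((c : K) • G) ∧
    Semistable K d ((c : K) • F) ((c : K) • G)

/-- The reduction of (a normalized rescaling of) the pair `(F,G)` lies outside `I(d)`. -/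
def RedOutsideI (d : ℕ) (F G : MvPolynomial (Fin 2) K) : Prop :=
  ∃ c : Kˣ, Normalized K ((c : K) • F) ((c : K) • G) ∧
    ¬ Ilocus K d ((c : K) • F) ((c : K) • G)

/-- The `m`-th term (`m ≥ 1`) of Tate's series `x(w)`. -/
def tateTerm (q w : K) (m : ℕ) : K :=
  q ^ m * w / (1 - q ^ m * w) ^ 2 + q ^ m * w⁻¹ / (1 - q ^ m * w⁻¹) ^ 2
    - 2 * (q ^ m / (1 - q ^ m) ^ 2)

/-- Tate's series `x(w)` for the Tate curve with parameter `q`. -/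
def xTate (q w : K) : K :=
  w / (1 - w) ^ 2 + ∑' m : ℕ, tateTerm K q w (m + 1)

section Dehomogenization

variable {S : Type*} [CommRing S]

/-- The coefficient of `X ^ (e - i) * Y ^ i`. -/
def cf (e : ℕ) (F : MvPolynomial (Fin 2) S) (i : ℕ) : S :=
  MvPolynomial.coeff (Finsupp.single 0 (e - i) + Finsupp.single 1 i) F

lemma exponent_eq {e : ℕ} {m : Fin 2 →₀ ℕ} (h : m.degree = e) :
    m = Finsupp.single 0 (e - m 1) + Finsupp.single 1 (m 1) ∧ m 1 ≤ e := by
  have h2 : m 0 + m 1 = e := by rw [← h, Finsupp.degree_eq_sum, Fin.sum_univ_two]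
  refine ⟨?_, by omega⟩
  ext i
  fin_cases i
  · simp; omega
  · simp

/-- Dehomogenization of a binary form: setting `X = 1`. -/
def deh : MvPolynomial (Fin 2) S →ₐ[S] Polynomial S :=
  MvPolynomial.aeval ![1, Polynomial.X]

lemma coeff_deh {e : ℕ} {F : MvPolynomial (Fin 2) S} (hF : F.IsHomogeneous e) (i : ℕ) :
    (deh F).coeff i = if i ≤ e then cf e F i else 0 := by
  have h1 : deh F = ∑ m ∈ F.support, Polynomial.monomial (m 1) (F.coeff m) := by
    conv_lhs => rw [F.as_sum, map_sum]
    refine Finset.sum_congr rfl fun m _ => ?_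
    rw [deh, MvPolynomial.aeval_monomial, Finsupp.prod_fintype _ _ (by simp)]
    simp [Polynomial.C_mul_X_pow_eq_monomial]
  rw [h1, Polynomial.finsetSum_coeff]
  simp only [Polynomial.coeff_monomial]
  have key : ∀ m ∈ F.support, m 1 = i →
      m = Finsupp.single 0 (e - i) + Finsupp.single 1 i ∧ i ≤ e := by
    intro m hm hi
    have := exponent_eq (hF.degree_eq_sum_deg_support hm).symm
    rwa [hi] at this
  split_ifs with hi
  · rw [Finset.sum_eq_single (Finsupp.single 0 (e - i) + Finsupp.single 1 i)]
    · simp [cf]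
    · intro m hm hne
      rw [if_neg]
      exact fun h => hne (key m hm h).1
    · intro h
      simpa using h
  · refine Finset.sum_eq_zero fun m hm => ?_
    rw [if_neg]
    exact fun h => hi (key m hm h).2

lemma natDegree_deh_le {e : ℕ} {F : MvPolynomial (Fin 2) S} (hF : F.IsHomogeneous e) :
    (deh F).natDegree ≤ e := by
  rw [Polynomial.natDegree_le_iff_coeff_eq_zero]
  intro i hi
  rw [coeff_deh hF, if_neg (by omega)]

lemma bres_eq_resultant {e : ℕ} {F G : MvPolynomial (Fin 2) S} (hF : F.IsHomogeneous e)
    (hG : G.IsHomogeneous e) : bres e F G = (deh G).resultant (deh F) e e := by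
  rw [bres, Polynomial.resultant, ← Matrix.det_transpose]
  congr 1
  ext i j
  induction j using Fin.addCases with
  | left j =>
    simp only [Matrix.transpose_apply, sylv, Polynomial.sylvester, Matrix.of_apply,
      Fin.addCases_left, Fin.val_castAdd, j.2, dite_true, Set.mem_Icc]
    split_ifs with h
    · rw [coeff_deh hF, if_pos (by omega)]; rfl
    · rfl
  | right j =>
    simp only [Matrix.transpose_apply, sylv, Polynomial.sylvester, Matrix.of_apply,
      Fin.addCases_right, Fin.val_natAdd, Set.mem_Icc, add_tsub_cancel_left]
    rw [dif_neg (by omega)]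
    by_cases h : (j : ℕ) ≤ i ∧ (i : ℕ) ≤ j + e
    · rw [if_pos h, dif_pos (by omega), coeff_deh hG, if_pos (by omega)]; rfl
    · rw [if_neg h, dif_neg (by omega)]

end Dehomogenization

namespace Polynomial

variable {S : Type*} [CommRing S]

lemma resultant_mul_left_of_le {f₁ f₂ g : S[X]} {m₁ m₂ n : ℕ} (h₁ : f₁.natDegree ≤ m₁)
    (h₂ : f₂.natDegree ≤ m₂) (hg : g.natDegree ≤ n) :
    resultant (f₁ * f₂) g (m₁ + m₂) n = resultant f₁ g m₁ n * resultant f₂ g m₂ n := by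
  obtain ⟨k₁, rfl⟩ := Nat.exists_eq_add_of_le h₁
  obtain ⟨k₂, rfl⟩ := Nat.exists_eq_add_of_le h₂
  rw [show f₁.natDegree + k₁ + (f₂.natDegree + k₂) = f₁.natDegree + f₂.natDegree + (k₁ + k₂) by
    ring, resultant_add_left_deg _ _ _ _ _ natDegree_mul_le,
    resultant_add_left_deg _ _ _ _ _ le_rfl, resultant_add_left_deg _ _ _ _ _ le_rfl, resultant_mul_left _ _ _ _ hg]
  ring

lemma resultant_mul_right_of_le {f g₁ g₂ : S[X]} {m n₁ n₂ : ℕ} (h₁ : g₁.natDegree ≤ n₁)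
    (h₂ : g₂.natDegree ≤ n₂) (hf : f.natDegree ≤ m) :
    resultant f (g₁ * g₂) m (n₁ + n₂) = resultant f g₁ m n₁ * resultant f g₂ m n₂ := by
  rw [resultant_comm, resultant_mul_left_of_le h₁ h₂ hf, resultant_comm f, resultant_comm f]
  ring

lemma resultant_linear_comb {k : Type*} [Field k] {f g : k[X]} {e : ℕ} (hf : f.natDegree ≤ e)
    (hg : g.natDegree ≤ e) (a b c d : k) :
    resultant (C a * f + C b * g) (C c * f + C d * g) e e =
      (a * d - b * c) ^ e * resultant f g e e := by
  by_cases ha : a = 0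
  · subst ha
    have h1 : C c * f + C d * g = C c * f + g * C d := by ring
    rw [C_0, zero_mul, zero_add, resultant_C_mul_left, h1,
      resultant_add_mul_right _ _ _ _ _ (by simp) hg, resultant_C_mul_right, resultant_comm]
    have h2 : ((-1 : k)) ^ (e * e) = (-1) ^ e := by
      rcases Nat.even_or_odd e with h | h
      · rw [h.neg_one_pow, (h.mul_left e).neg_one_pow]
      · rw [h.neg_one_pow, (h.mul h).neg_one_pow]
    rw [h2, ← mul_assoc, ← mul_assoc, ← mul_pow, ← mul_pow]
    ring
  · have h1 : C c * f + C d * g =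
        C (d - b * c / a) * g + (C a * f + C b * g) * C (c / a) := by
      have h2 : C c = C a * C (c / a) := by rw [← C_mul]; congr 1; field_simp
      have h3 : C (d - b * c / a) = C d - C b * C (c / a) := by
        rw [← C_mul, ← C_sub]; congr 1; ring
      rw [h3, h2]; ring
    have hfg : (C a * f + C b * g).natDegree ≤ e :=
      (natDegree_add_le _ _).trans (max_le ((natDegree_C_mul_le _ _).trans hf)
        ((natDegree_C_mul_le _ _).trans hg))
    rw [h1, resultant_add_mul_right _ _ _ _ _ (by simp) hfg, resultant_C_mul_right]
    have h4 : C a * f + C b * g = C a * f + g * C b := by ring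
    rw [h4, resultant_add_mul_left _ _ _ _ _ (by simp) hg, resultant_C_mul_left, ← mul_assoc,
      ← mul_pow]
    congr 2
    field_simp

end Polynomial

section Substitution

variable {S : Type*} [CommRing S]

/-- Linear substitution of a `2×2` matrix into a binary form, as an algebra homomorphism. -/
def linSubst (M : Matrix (Fin 2) (Fin 2) S) :
    MvPolynomial (Fin 2) S →ₐ[S] MvPolynomial (Fin 2) S :=
  MvPolynomial.aeval ![C (M 0 0) * X 0 + C (M 0 1) * X 1, C (M 1 0) * X 0 + C (M 1 1) * X 1]

lemma linSubst_X_zero (M : Matrix (Fin 2) (Fin 2) S) :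
    linSubst M (X 0) = C (M 0 0) * X 0 + C (M 0 1) * X 1 := by simp [linSubst]

lemma linSubst_X_one (M : Matrix (Fin 2) (Fin 2) S) :
    linSubst M (X 1) = C (M 1 0) * X 0 + C (M 1 1) * X 1 := by simp [linSubst]

@[simp]
lemma linSubst_C (M : Matrix (Fin 2) (Fin 2) S) (c : S) : linSubst M (C c) = C c := by
  simp [linSubst]

lemma linSubst_mul (M N : Matrix (Fin 2) (Fin 2) S) (F : MvPolynomial (Fin 2) S) :
    linSubst (M * N) F = linSubst N (linSubst M F) := by
  suffices h : linSubst (M * N) = (linSubst N).comp (linSubst M) by rw [h]; rfl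
  apply MvPolynomial.algHom_ext
  intro i
  fin_cases i <;>
    simp only [Fin.zero_eta, Fin.mk_one, AlgHom.comp_apply, linSubst_X_zero, linSubst_X_one,
      map_add, map_mul, linSubst_C, Matrix.mul_apply, Fin.sum_univ_two] <;> ring

lemma linSubst_one (F : MvPolynomial (Fin 2) S) : linSubst 1 F = F := by
  suffices h : linSubst (1 : Matrix (Fin 2) (Fin 2) S) = AlgHom.id S _ by rw [h]; rfl
  apply MvPolynomial.algHom_ext
  intro i
  fin_cases i <;> simp [linSubst]

lemma map_linSubst {T : Type*} [CommRing T] (φ : S →+* T) (M : Matrix (Fin 2) (Fin 2) S)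
    (F : MvPolynomial (Fin 2) S) :
    MvPolynomial.map φ (linSubst M F) = linSubst (M.map φ) (MvPolynomial.map φ F) := by
  induction F using MvPolynomial.induction_on with
  | C a => simp
  | add p q hp hq => simp [hp, hq]
  | mul_X p i hp =>
    rw [map_mul, map_mul, hp, map_mul, map_mul]
    congr 1
    fin_cases i <;> simp [linSubst]

lemma isHomogeneous_linear (a b : S) :
    (C a * X 0 + C b * X 1 : MvPolynomial (Fin 2) S).IsHomogeneous 1 :=
  (isHomogeneous_C_mul_X _ _).add (isHomogeneous_C_mul_X _ _)

lemma isHomogeneous_linSubst (M : Matrix (Fin 2) (Fin 2) S) {F : MvPolynomial (Fin 2) S} {e : ℕ}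
    (hF : F.IsHomogeneous e) : (linSubst M F).IsHomogeneous e := by
  have key : ∀ i, ((![C (M 0 0) * X 0 + C (M 0 1) * X 1, C (M 1 0) * X 0 + C (M 1 1) * X 1] :
      Fin 2 → MvPolynomial (Fin 2) S) i).IsHomogeneous 1 :=
    Fin.forall_fin_two.2 ⟨isHomogeneous_linear _ _, isHomogeneous_linear _ _⟩
  have := hF.aeval _ key
  rw [one_mul] at this
  exact this

lemma eval_linSubst (M : Matrix (Fin 2) (Fin 2) S) (v : Fin 2 → S) (F : MvPolynomial (Fin 2) S) :
    eval v (linSubst M F) = eval (M *ᵥ v) F := by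
  induction F using MvPolynomial.induction_on with
  | C a => simp
  | add p q hp hq => simp [hp, hq]
  | mul_X p i hp =>
    rw [map_mul, map_mul, hp, map_mul]
    congr 1
    fin_cases i <;> simp [linSubst]

lemma coeff_linSubst_diagonal (α δ : S) (F : MvPolynomial (Fin 2) S) (m : Fin 2 →₀ ℕ) :
    (linSubst !![α, 0; 0, δ] F).coeff m = α ^ m 0 * δ ^ m 1 * F.coeff m := by
  induction F using MvPolynomial.induction_on' with
  | monomial u a =>
    have : linSubst !![α, 0; 0, δ] (monomial u a) = monomial u (α ^ u 0 * δ ^ u 1 * a) := by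
      rw [linSubst, aeval_monomial, Finsupp.prod_fintype _ _ (by simp), Fin.prod_univ_two,
        monomial_eq, Finsupp.prod_fintype _ _ (by simp), Fin.prod_univ_two]
      simp only [algebraMap_eq, of_apply, cons_val', cons_val_zero, cons_val_fin_one, cons_val_one,
        map_zero, zero_mul, add_zero, zero_add, mul_pow, map_mul, map_pow]
      ring
    rw [this, coeff_monomial, coeff_monomial]
    split_ifs with h
    · rw [h]
    · simp
  | add p q hp hq => rw [map_add, coeff_add, coeff_add, hp, hq]; ring

/-- The conjugate of a pair of binary forms by a `2×2` matrix, with the adjugate in place of the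
inverse. -/
def adjConj (M : Matrix (Fin 2) (Fin 2) S)
    (P : MvPolynomial (Fin 2) S × MvPolynomial (Fin 2) S) :
    MvPolynomial (Fin 2) S × MvPolynomial (Fin 2) S :=
  (C (M 1 1) * linSubst M P.1 - C (M 0 1) * linSubst M P.2,
   C (M 0 0) * linSubst M P.2 - C (M 1 0) * linSubst M P.1)

lemma adjConj_mul (M N : Matrix (Fin 2) (Fin 2) S)
    (P : MvPolynomial (Fin 2) S × MvPolynomial (Fin 2) S) :
    adjConj (M * N) P = adjConj N (adjConj M P) := by
  simp only [adjConj, linSubst_mul, map_sub, map_mul, linSubst_C, Matrix.mul_apply,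
    Fin.sum_univ_two, map_add]
  ext1 <;> simp only <;> ring

lemma adjConj_one (P : MvPolynomial (Fin 2) S × MvPolynomial (Fin 2) S) : adjConj 1 P = P := by
  simp [adjConj, linSubst_one]

lemma map_adjConj {T : Type*} [CommRing T] (φ : S →+* T) (M : Matrix (Fin 2) (Fin 2) S)
    (F G : MvPolynomial (Fin 2) S) :
    adjConj (M.map φ) (MvPolynomial.map φ F, MvPolynomial.map φ G) =
      (MvPolynomial.map φ (adjConj M (F, G)).1, MvPolynomial.map φ (adjConj M (F, G)).2) := by
  simp [adjConj, map_linSubst]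

lemma isHomogeneous_adjConj (M : Matrix (Fin 2) (Fin 2) S)
    {P : MvPolynomial (Fin 2) S × MvPolynomial (Fin 2) S} {e : ℕ}
    (h₁ : P.1.IsHomogeneous e) (h₂ : P.2.IsHomogeneous e) :
    (adjConj M P).1.IsHomogeneous e ∧ (adjConj M P).2.IsHomogeneous e :=
  ⟨((isHomogeneous_linSubst M h₁).C_mul _).sub ((isHomogeneous_linSubst M h₂).C_mul _),
    ((isHomogeneous_linSubst M h₂).C_mul _).sub ((isHomogeneous_linSubst M h₁).C_mul _)⟩

lemma cf_adjConj_diagonal (α δ : S) (P : MvPolynomial (Fin 2) S × MvPolynomial (Fin 2) S)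
    (e i : ℕ) :
    cf e (adjConj !![α, 0; 0, δ] P).1 i = α ^ (e - i) * δ ^ (i + 1) * cf e P.1 i ∧
    cf e (adjConj !![α, 0; 0, δ] P).2 i = α ^ (e - i + 1) * δ ^ i * cf e P.2 i := by
  constructor
  · simp only [adjConj, cf, coeff_sub, coeff_C_mul, coeff_linSubst_diagonal]
    simp
    ring
  · simp only [adjConj, cf, coeff_sub, coeff_C_mul, coeff_linSubst_diagonal]
    simp
    ring

end Substitution

section Divisibility

lemma X_one_pow_dvd_iff {S : Type*} [CommRing S] {F : MvPolynomial (Fin 2) S} {e s : ℕ}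
    (hF : F.IsHomogeneous e) :
    (X 1 : MvPolynomial (Fin 2) S) ^ s ∣ F ↔ ∀ i, i ≤ e → i < s → cf e F i = 0 := by
  rw [X_pow_eq_monomial, monomial_one_dvd_iff_modMonomial_eq_zero]
  constructor
  · intro h i _ hi
    have := congrArg (coeff (Finsupp.single 0 (e - i) + Finsupp.single 1 i)) h
    rwa [coeff_modMonomial_of_not_le, coeff_zero] at this
    intro hle
    have := hle 1
    simp at this
    omega
  · intro h
    ext m
    rw [coeff_zero]
    by_cases hle : Finsupp.single 1 s ≤ m
    · exact coeff_modMonomial_of_le _ hle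
    · rw [coeff_modMonomial_of_not_le _ hle]
      by_cases hm : m.degree = e
      · obtain ⟨h1, h2⟩ := exponent_eq hm
        rw [h1]
        refine h _ h2 ?_
        by_contra hlt
        apply hle
        rw [Finsupp.single_le_iff]
        omega
      · exact hF.coeff_eq_zero hm

/-- The polynomial `P(T X)` in `T`. -/
def scaleVars {S σ : Type*} [CommRing S] :
    MvPolynomial σ S →ₐ[S] Polynomial (MvPolynomial σ S) :=
  MvPolynomial.aeval fun i => Polynomial.C (X i) * Polynomial.X

lemma coeff_scaleVars {S σ : Type*} [CommRing S] (P : MvPolynomial σ S) (i : ℕ)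
    (m : σ →₀ ℕ) :
    ((scaleVars P).coeff i).coeff m = if m.degree = i then P.coeff m else 0 := by
  classical
  induction P using MvPolynomial.induction_on' with
  | monomial u a =>
    have : scaleVars (monomial u a) = Polynomial.monomial u.degree (monomial u a) := by
      rw [scaleVars, aeval_monomial]
      simp only [mul_pow, Finsupp.prod_mul, ← Polynomial.C_pow]
      rw [← Polynomial.C_mul_X_pow_eq_monomial, monomial_eq, Polynomial.C_mul, mul_assoc]
      congr 2
      · simp only [Finsupp.prod, map_prod]
      · rw [Finsupp.prod, Finset.prod_pow_eq_pow_sum, Finsupp.degree_apply]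
    rw [this, Polynomial.coeff_monomial]
    by_cases h : u = m
    · subst h; split_ifs <;> simp
    · split_ifs <;> simp [h]
  | add p q hp hq => rw [map_add, Polynomial.coeff_add, coeff_add, hp, hq]; split_ifs <;> simp

lemma isHomogeneous_of_scaleVars {S σ : Type*} [CommRing S] {P : MvPolynomial σ S} {n : ℕ}
    (h : ∀ i, i ≠ n → (scaleVars P).coeff i = 0) : P.IsHomogeneous n := by
  intro m hm
  by_contra hne
  apply hm
  have h1 := congrArg (coeff m) (h m.degree (by
    rwa [Finsupp.degree_eq_weight_one]))
  rwa [coeff_scaleVars, if_pos rfl, coeff_zero] at h1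

lemma MvPolynomial.IsHomogeneous.exists_of_mul {S σ : Type*} [CommRing S] [IsDomain S]
    {P Q : MvPolynomial σ S} {n : ℕ} (h : (P * Q).IsHomogeneous n) (h0 : P * Q ≠ 0) :
    ∃ i j, P.IsHomogeneous i ∧ Q.IsHomogeneous j ∧ i + j = n := by
  have hinj : ∀ {A : MvPolynomial σ S}, A ≠ 0 → scaleVars A ≠ 0 := by
    intro A hA h
    apply hA
    ext m
    have := coeff_scaleVars A m.degree m
    rw [if_pos rfl, h] at this
    simpa using this.symm
  have hP := hinj (left_ne_zero_of_mul h0)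
  have hQ := hinj (right_ne_zero_of_mul h0)
  have hmon : scaleVars (P * Q) = Polynomial.monomial n (P * Q) := by
    ext i m
    rw [coeff_scaleVars, Polynomial.coeff_monomial]
    by_cases hi : n = i
    · subst hi
      rw [if_pos rfl]
      split_ifs with hm
      · rfl
      · exact (h.coeff_eq_zero hm).symm
    · rw [if_neg hi, coeff_zero]
      split_ifs with hm
      · exact h.coeff_eq_zero (by omega)
      · rfl
  have hd : (scaleVars P).natDegree + (scaleVars Q).natDegree = n := by
    rw [← Polynomial.natDegree_mul hP hQ, ← map_mul, hmon, Polynomial.natDegree_monomial_eq _ h0]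
  have ht : (scaleVars P).natTrailingDegree + (scaleVars Q).natTrailingDegree = n := by
    rw [← Polynomial.natTrailingDegree_mul hP hQ, ← map_mul, hmon,
      Polynomial.natTrailingDegree_monomial h0]
  have hP' := (scaleVars P).natTrailingDegree_le_natDegree
  have hQ' := (scaleVars Q).natTrailingDegree_le_natDegree
  refine ⟨(scaleVars P).natDegree, (scaleVars Q).natDegree, isHomogeneous_of_scaleVars ?_,
    isHomogeneous_of_scaleVars ?_, hd⟩
  · intro i hi
    rcases lt_or_gt_of_ne hi with h | h
    · exact Polynomial.coeff_eq_zero_of_lt_natTrailingDegree (by omega)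
    · exact Polynomial.coeff_eq_zero_of_natDegree_lt h
  · intro i hi
    rcases lt_or_gt_of_ne hi with h | h
    · exact Polynomial.coeff_eq_zero_of_lt_natTrailingDegree (by omega)
    · exact Polynomial.coeff_eq_zero_of_natDegree_lt h

lemma IsRelPrime.dvd_of_dvd_mul_of_dvd_mul {α : Type*} [CommRing α] [IsDomain α]
    [UniqueFactorizationMonoid α] {c A f g : α} (hfg : IsRelPrime f g) (hf : c ∣ A * f)
    (hg : c ∣ A * g) : c ∣ A := by
  by_cases hA : A = 0
  · simp [hA]
  obtain ⟨A', c', h, hrel, hA', hc'⟩ := UniqueFactorizationMonoid.exists_reduced_factors A hA c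
  have hh : h ≠ 0 := by rintro rfl; simp at hA'; exact hA hA'.symm
  rw [← hA', ← hc', mul_assoc] at hf hg
  have hf' : c' ∣ f := hrel.symm.dvd_of_dvd_mul_left ((mul_dvd_mul_iff_left hh).1 hf)
  have hg' : c' ∣ g := hrel.symm.dvd_of_dvd_mul_left ((mul_dvd_mul_iff_left hh).1 hg)
  rw [← hA', ← hc']
  exact mul_dvd_mul_left h ((hfg hf' hg').dvd)

end Divisibility

section LinearFactor

variable {k : Type*} [Field k]

/-- The linear form vanishing at `[a : b]`. -/
def linForm (a b : k) : MvPolynomial (Fin 2) k := C b * X 0 - C a * X 1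

lemma isHomogeneous_linForm (a b : k) : (linForm a b).IsHomogeneous 1 :=
  (isHomogeneous_C_mul_X _ _).sub (isHomogeneous_C_mul_X _ _)

lemma exists_matrix_first_column {a b : k} (h : ¬(a = 0 ∧ b = 0)) :
    ∃ N : Matrix (Fin 2) (Fin 2) k, N 0 0 = a ∧ N 1 0 = b ∧ N.det ≠ 0 := by
  by_cases ha : a = 0
  · refine ⟨!![a, 1; b, 0], rfl, rfl, ?_⟩
    simpa [Matrix.det_fin_two, ha] using fun hb => h ⟨ha, hb⟩
  · exact ⟨!![a, 0; b, 1], rfl, rfl, by simpa [Matrix.det_fin_two] using ha⟩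

lemma linSubst_linForm (N : Matrix (Fin 2) (Fin 2) k) :
    linSubst N (linForm (N 0 0) (N 1 0)) = C (-N.det) * X 1 := by
  simp only [linForm, map_sub, map_mul, linSubst_C, linSubst_X_zero, linSubst_X_one,
    Matrix.det_fin_two, map_neg]
  ring

/-- Substitution of an invertible matrix as an algebra equivalence. -/
def linSubstEquiv (N : Matrix (Fin 2) (Fin 2) k) (hN : N.det ≠ 0) :
    MvPolynomial (Fin 2) k ≃ₐ[k] MvPolynomial (Fin 2) k :=
  AlgEquiv.ofAlgHom (linSubst N) (linSubst N⁻¹)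
    (AlgHom.ext fun F => by
      rw [AlgHom.comp_apply, ← linSubst_mul, Matrix.nonsing_inv_mul _ (isUnit_iff_ne_zero.2 hN),
        linSubst_one]; rfl)
    (AlgHom.ext fun F => by
      rw [AlgHom.comp_apply, ← linSubst_mul, Matrix.mul_nonsing_inv _ (isUnit_iff_ne_zero.2 hN),
        linSubst_one]; rfl)

lemma linSubst_dvd_linSubst_iff {N : Matrix (Fin 2) (Fin 2) k} (hN : N.det ≠ 0)
    {F G : MvPolynomial (Fin 2) k} : linSubst N F ∣ linSubst N G ↔ F ∣ G :=
  map_dvd_iff (linSubstEquiv N hN)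

lemma linForm_pow_dvd_iff {N : Matrix (Fin 2) (Fin 2) k} (hN : N.det ≠ 0) (s : ℕ)
    {F : MvPolynomial (Fin 2) k} :
    linForm (N 0 0) (N 1 0) ^ s ∣ F ↔ X 1 ^ s ∣ linSubst N F := by
  rw [← linSubst_dvd_linSubst_iff hN, map_pow, linSubst_linForm, mul_pow]
  exact (((isUnit_iff_ne_zero.2 (neg_ne_zero.2 hN)).map C).pow s).mul_left_dvd

lemma prime_linForm {a b : k} (h : ¬(a = 0 ∧ b = 0)) : Prime (linForm a b) := by
  obtain ⟨N, rfl, rfl, hN⟩ := exists_matrix_first_column h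
  rw [← MulEquiv.prime_iff (linSubstEquiv N hN).toMulEquiv]
  have h1 : (linSubstEquiv N hN).toMulEquiv (linForm (N 0 0) (N 1 0)) = C (-N.det) * X 1 :=
    linSubst_linForm N
  rw [h1]
  have hu : Associated (X 1 : MvPolynomial (Fin 2) k) (C (-N.det) * X 1) :=
    (associated_unit_mul_left _ _ ((isUnit_iff_ne_zero.2 (neg_ne_zero.2 hN)).map C)).symm
  exact hu.prime (X_prime (i := 1))

lemma linForm_dvd_of_eval_eq_zero {a b : k} (h : ¬(a = 0 ∧ b = 0)) {F : MvPolynomial (Fin 2) k}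
    {e : ℕ} (hF : F.IsHomogeneous e) (h0 : eval ![a, b] F = 0) : linForm a b ∣ F := by
  obtain ⟨N, rfl, rfl, hN⟩ := exists_matrix_first_column h
  rw [← pow_one (linForm _ _), linForm_pow_dvd_iff hN,
    X_one_pow_dvd_iff (isHomogeneous_linSubst N hF)]
  intro i _ hi
  obtain rfl : i = 0 := by omega
  have h1 : eval ![1, 0] (linSubst N F) = 0 := by
    have hv : N *ᵥ ![1, 0] = ![N 0 0, N 1 0] := by
      ext i
      fin_cases i <;> simp [Matrix.mulVec, dotProduct, Fin.sum_univ_two]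
    rw [eval_linSubst, hv, h0]
  rw [← h1, eval_eq', Finset.sum_eq_single (Finsupp.single 0 (e - 0) + Finsupp.single 1 0)]
  · simp [cf, Fin.prod_univ_two]
  · intro m hm hne
    have h2 := exponent_eq ((isHomogeneous_linSubst N hF).degree_eq_sum_deg_support hm).symm
    have h3 : m 1 ≠ 0 := by
      intro h3
      rw [h3] at h2
      exact hne h2.1
    simp [Fin.prod_univ_two, h3]
  · intro hm
    simp at hm
    simp [hm]

lemma eval_linForm_self (a b : k) : eval ![a, b] (linForm a b) = 0 := by
  simp [linForm]; ring

end LinearFactor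

section Composition

variable {k : Type*} [Field k]

lemma eval_deh {S : Type*} [CommRing S] (y : S) (F : MvPolynomial (Fin 2) S) :
    Polynomial.eval y (deh F) = eval ![1, y] F := by
  induction F using MvPolynomial.induction_on with
  | C a => simp [deh, Polynomial.algebraMap_eq]
  | add p q hp hq => simp [hp, hq]
  | mul_X p i hp =>
    rw [map_mul, Polynomial.eval_mul, hp, map_mul]
    congr 1
    fin_cases i <;> simp [deh]

lemma eval_zero_left_eq_zero {S : Type*} [CommRing S] {F : MvPolynomial (Fin 2) S} {d : ℕ}
    (hF : F.IsHomogeneous d) (h : cf d F d = 0) (b : S) : eval ![0, b] F = 0 := by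
  rw [eval_eq']
  refine Finset.sum_eq_zero fun m hm => ?_
  have h2 := exponent_eq (hF.degree_eq_sum_deg_support hm).symm
  by_cases hm0 : m 0 = 0
  · exfalso
    have h3 : m 1 = d := by
      have := congrArg (fun f => f 0) h2.1
      simp [hm0] at this
      omega
    rw [h3] at h2
    rw [mem_support_iff, h2.1] at hm
    exact hm h
  · simp [Fin.prod_univ_two, hm0]

lemma exists_eq_linForm_mul [IsAlgClosed k] {F : MvPolynomial (Fin 2) k} {d : ℕ}
    (hF : F.IsHomogeneous (d + 1)) :
    ∃ a b F', ¬(a = 0 ∧ b = 0) ∧ F'.IsHomogeneous d ∧ F = linForm a b * F' := by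
  by_cases h0 : F = 0
  · exact ⟨1, 0, 0, by simp, isHomogeneous_zero _ _ _, by simp [h0]⟩
  obtain ⟨a, b, hab, hev⟩ : ∃ a b : k, ¬(a = 0 ∧ b = 0) ∧ eval ![a, b] F = 0 := by
    by_cases hc : (deh F).degree = 0
    · refine ⟨0, 1, by simp, ?_⟩
      have h1 : cf (d + 1) F (d + 1) = 0 := by
        have := coeff_deh hF (d + 1)
        rw [if_pos le_rfl] at this
        rw [← this]
        exact Polynomial.coeff_eq_zero_of_degree_lt (by rw [hc]; exact_mod_cast Nat.succ_pos d)
      exact eval_zero_left_eq_zero hF h1 1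
    · obtain ⟨y, hy⟩ := IsAlgClosed.exists_root _ hc
      refine ⟨1, y, by simp, ?_⟩
      rw [← eval_deh]
      exact hy
  obtain ⟨F', rfl⟩ := linForm_dvd_of_eval_eq_zero hab hF hev
  obtain ⟨i, j, hi, hj, hij⟩ := hF.exists_of_mul h0
  have : i = 1 := hi.inj_right (isHomogeneous_linForm a b) (left_ne_zero_of_mul h0)
  exact ⟨a, b, F', hab, by rwa [show d = j by omega], rfl⟩

lemma natDegree_aeval_le {p q : Polynomial k} {e d : ℕ} (hp : p.natDegree ≤ e)
    (hq : q.natDegree ≤ e) {F : MvPolynomial (Fin 2) k} (hF : F.IsHomogeneous d) :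
    (aeval ![p, q] F).natDegree ≤ d * e := by
  rw [F.as_sum, map_sum]
  refine Polynomial.natDegree_sum_le_of_forall_le _ _ fun m hm => ?_
  have h := exponent_eq (hF.degree_eq_sum_deg_support hm).symm
  rw [aeval_monomial, Finsupp.prod_fintype _ _ (by simp), Fin.prod_univ_two]
  have h0 : m 0 + m 1 = d := by
    have := congrArg (fun f => f 0) h.1
    simp at this
    omega
  refine (Polynomial.natDegree_C_mul_le _ _).trans (Polynomial.natDegree_mul_le.trans ?_)
  rw [← h0, add_mul]
  exact add_le_add (Polynomial.natDegree_pow_le.trans (Nat.mul_le_mul_left _ hp))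
    (Polynomial.natDegree_pow_le.trans (Nat.mul_le_mul_left _ hq))

lemma resultant_aeval_linForm {p q : Polynomial k} {e : ℕ} (hp : p.natDegree ≤ e)
    (hq : q.natDegree ≤ e) (a b c d : k) :
    (aeval ![p, q] (linForm a b)).resultant (aeval ![p, q] (linForm c d)) e e =
      (deh (linForm a b)).resultant (deh (linForm c d)) 1 1 ^ e * q.resultant p e e := by
  have h : ∀ (p q : Polynomial k) (a b : k), aeval ![p, q] (linForm a b) =
      Polynomial.C (-a) * q + Polynomial.C b * p := by
    intro p q a b
    simp [linForm, Polynomial.algebraMap_eq]; ring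
  rw [deh, h, h, h, h, Polynomial.resultant_linear_comb hq hp,
    Polynomial.resultant_linear_comb Polynomial.natDegree_X_le (by simp)]
  simp

lemma resultant_aeval [IsAlgClosed k] {p q : Polynomial k} {e : ℕ} (hp : p.natDegree ≤ e)
    (hq : q.natDegree ≤ e) {d₁ d₂ : ℕ} {F G : MvPolynomial (Fin 2) k} (hF : F.IsHomogeneous d₁)
    (hG : G.IsHomogeneous d₂) :
    (aeval ![p, q] F).resultant (aeval ![p, q] G) (d₁ * e) (d₂ * e) =
      (deh F).resultant (deh G) d₁ d₂ ^ e * q.resultant p e e ^ (d₁ * d₂) := by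
  have hC : ∀ H : MvPolynomial (Fin 2) k, H.IsHomogeneous 0 → ∃ c, H = C c := by
    intro H hH
    exact ⟨_, totalDegree_eq_zero_iff_eq_C.1 ((totalDegree_zero_iff_isHomogeneous _).2 hH)⟩
  have hlin := isHomogeneous_linForm (k := k)
  have hd : ∀ {n : ℕ} {H : MvPolynomial (Fin 2) k}, H.IsHomogeneous n →
      (aeval ![p, q] H).natDegree ≤ n * e := fun h => natDegree_aeval_le hp hq h
  have hd1 : ∀ a b : k, (aeval ![p, q] (linForm a b)).natDegree ≤ e := fun a b => by
    simpa using hd (hlin a b)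
  have hlinear : ∀ (a b : k) (d₂ : ℕ) (G : MvPolynomial (Fin 2) k), G.IsHomogeneous d₂ →
      (aeval ![p, q] (linForm a b)).resultant (aeval ![p, q] G) e (d₂ * e) =
      (deh (linForm a b)).resultant (deh G) 1 d₂ ^ e * q.resultant p e e ^ d₂ := by
    intro a b d₂
    induction d₂ with
    | zero =>
      intro G hG
      obtain ⟨c, rfl⟩ := hC G hG
      simp [deh, Polynomial.algebraMap_eq]
    | succ n ih =>
      intro G hG
      obtain ⟨c, d, G', -, hG', rfl⟩ := exists_eq_linForm_mul hG
      rw [map_mul, map_mul, show (n + 1) * e = e + n * e by ring, add_comm n 1,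
        Polynomial.resultant_mul_right_of_le (hd1 c d) (hd hG') (hd1 a b),
        Polynomial.resultant_mul_right_of_le (natDegree_deh_le (hlin c d)) (natDegree_deh_le hG')
          (natDegree_deh_le (hlin a b)), ih G' hG', resultant_aeval_linForm hp hq]
      ring
  induction d₁ generalizing F with
  | zero =>
    obtain ⟨c, rfl⟩ := hC F hF
    simp [deh, Polynomial.algebraMap_eq, pow_mul]
  | succ n ih =>
    obtain ⟨a, b, F', -, hF', rfl⟩ := exists_eq_linForm_mul hF
    rw [map_mul, map_mul, show (n + 1) * e = e + n * e by ring, add_comm n 1,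
      Polynomial.resultant_mul_left_of_le (hd1 a b) (hd hF') (hd hG),
      Polynomial.resultant_mul_left_of_le (natDegree_deh_le (hlin a b)) (natDegree_deh_le hF')
        (natDegree_deh_le hG), ih hF', hlinear a b d₂ G hG]
    ring

lemma isHomogeneous_comp2 {S : Type*} [CommRing S] {F f g : MvPolynomial (Fin 2) S} {d e : ℕ}
    (hF : F.IsHomogeneous d) (hf : f.IsHomogeneous e) (hg : g.IsHomogeneous e) :
    (comp2 F f g).IsHomogeneous (d * e) := by
  have key : ∀ i, ((![f, g] : Fin 2 → MvPolynomial (Fin 2) S) i).IsHomogeneous e :=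
    Fin.forall_fin_two.2 ⟨hf, hg⟩
  rw [mul_comm]
  exact hF.aeval _ key

lemma deh_comp2 {S : Type*} [CommRing S] (F f g : MvPolynomial (Fin 2) S) :
    deh (comp2 F f g) = aeval ![deh f, deh g] F := by
  have h : deh.comp (aeval ![f, g]) = aeval (R := S) ![deh f, deh g] := by
    apply MvPolynomial.algHom_ext
    intro i
    fin_cases i <;> simp
  exact DFunLike.congr_fun h F

lemma bres_comp2 [IsAlgClosed k] {F G f g : MvPolynomial (Fin 2) k} {d e : ℕ}
    (hF : F.IsHomogeneous d) (hG : G.IsHomogeneous d) (hf : f.IsHomogeneous e)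
    (hg : g.IsHomogeneous e) :
    bres (d * e) (comp2 F f g) (comp2 G f g) = bres d F G ^ e * bres e f g ^ (d * d) := by
  rw [bres_eq_resultant (isHomogeneous_comp2 hF hf hg) (isHomogeneous_comp2 hG hf hg),
    bres_eq_resultant hF hG, bres_eq_resultant hf hg, deh_comp2, deh_comp2,
    resultant_aeval (natDegree_deh_le hf) (natDegree_deh_le hg) hG hF]

lemma bres_linear (M : Matrix (Fin 2) (Fin 2) k) :
    bres 1 (C (M 0 0) * X 0 + C (M 0 1) * X 1) (C (M 1 0) * X 0 + C (M 1 1) * X 1) = M.det := by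
  have h : ∀ a b : k, deh (C a * X 0 + C b * X 1) =
      Polynomial.C b * Polynomial.X + Polynomial.C a * 1 := by
    intro a b
    simp [deh, Polynomial.algebraMap_eq]; ring
  rw [bres_eq_resultant (isHomogeneous_linear _ _) (isHomogeneous_linear _ _), h, h,
    Polynomial.resultant_linear_comb Polynomial.natDegree_X_le (by simp), Matrix.det_fin_two]
  simp
  ring

lemma bres_adjConj [IsAlgClosed k] {F G : MvPolynomial (Fin 2) k} {d : ℕ}
    (hF : F.IsHomogeneous d) (hG : G.IsHomogeneous d) (M : Matrix (Fin 2) (Fin 2) k) :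
    bres d (adjConj M (F, G)).1 (adjConj M (F, G)).2 = M.det ^ (d + d * d) * bres d F G := by
  have h1 : (adjConj M (F, G)).1 =
      comp2 (C (M 1 1) * X 0 + C (-M 0 1) * X 1) (linSubst M F) (linSubst M G) := by
    simp [adjConj, comp2, sub_eq_add_neg, algebraMap_eq]
  have h2 : (adjConj M (F, G)).2 =
      comp2 (C (-M 1 0) * X 0 + C (M 0 0) * X 1) (linSubst M F) (linSubst M G) := by
    simp [adjConj, comp2, algebraMap_eq]; ring
  have h3 := bres_comp2 (isHomogeneous_linear (M 1 1) (-M 0 1))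
    (isHomogeneous_linear (-M 1 0) (M 0 0)) (isHomogeneous_linSubst M hF)
    (isHomogeneous_linSubst M hG)
  have h4 := bres_comp2 hF hG (isHomogeneous_linear (M 0 0) (M 0 1))
    (isHomogeneous_linear (M 1 0) (M 1 1))
  rw [bres_linear, mul_one, pow_one] at h4
  have h5 := bres_linear !![M 1 1, -M 0 1; -M 1 0, M 0 0]
  simp only [of_apply, cons_val', cons_val_zero, cons_val_fin_one, cons_val_one] at h5
  rw [one_mul, one_mul, pow_one, h5] at h3
  rw [h1, h2, h3]
  change _ * bres d (comp2 F _ _) (comp2 G _ _) = _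
  rw [h4, Matrix.det_fin_two, Matrix.det_fin_two]
  simp
  ring

lemma bres_C_mul {S : Type*} [CommRing S] (c : S) {F G : MvPolynomial (Fin 2) S} {d : ℕ}
    (hF : F.IsHomogeneous d) (hG : G.IsHomogeneous d) :
    bres d (C c * F) (C c * G) = c ^ (2 * d) * bres d F G := by
  rw [bres_eq_resultant (hF.C_mul c) (hG.C_mul c), bres_eq_resultant hF hG, map_mul, map_mul]
  have : deh (C c) = Polynomial.C c := by simp [deh, Polynomial.algebraMap_eq]
  rw [this, Polynomial.resultant_C_mul_left, Polynomial.resultant_C_mul_right]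
  ring

lemma resultant_ne_zero_of_isRelPrime [IsAlgClosed k] {F G : MvPolynomial (Fin 2) k} {d₁ d₂ : ℕ}
    (hF : F.IsHomogeneous d₁) (hG : G.IsHomogeneous d₂) (hF0 : F ≠ 0) (h : IsRelPrime F G) :
    (deh F).resultant (deh G) d₁ d₂ ≠ 0 := by
  induction d₁ generalizing F with
  | zero =>
    obtain ⟨c, rfl⟩ : ∃ c, F = C c :=
      ⟨_, totalDegree_eq_zero_iff_eq_C.1 ((totalDegree_zero_iff_isHomogeneous _).2 hF)⟩
    have : c ≠ 0 := by rintro rfl; simp at hF0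
    simp [deh, Polynomial.algebraMap_eq, this]
  | succ n ih =>
    obtain ⟨a, b, F', hab, hF', rfl⟩ := exists_eq_linForm_mul hF
    rw [map_mul, add_comm n 1, Polynomial.resultant_mul_left_of_le
      (natDegree_deh_le (isHomogeneous_linForm a b)) (natDegree_deh_le hF') (natDegree_deh_le hG)]
    refine mul_ne_zero ?_ (ih hF' (right_ne_zero_of_mul hF0) h.of_mul_left_right)
    have hev : eval ![a, b] G ≠ 0 := by
      intro h0
      exact (prime_linForm hab).not_isUnit
        (h (dvd_mul_right _ _) (linForm_dvd_of_eval_eq_zero hab hG h0))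
    intro hres
    apply hev
    have hlin : deh (linForm a b) = Polynomial.C b - Polynomial.C a * Polynomial.X := by
      simp [deh, linForm, Polynomial.algebraMap_eq]
    by_cases ha : a = 0
    · subst ha
      have hb : b ≠ 0 := fun hb => hab ⟨rfl, hb⟩
      rw [hlin, Polynomial.C_0, zero_mul, sub_zero, Polynomial.resultant_C_left, coeff_deh hG,
        if_pos le_rfl] at hres
      exact eval_zero_left_eq_zero hG (by simpa [hb] using hres) b
    · have h1 : Polynomial.C b - Polynomial.C a * Polynomial.X =
          Polynomial.C (-a) * (Polynomial.X - Polynomial.C (b / a)) := by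
        rw [mul_sub, ← Polynomial.C_mul, show -a * (b / a) = -b by field_simp]
        simp only [Polynomial.C_neg]
        ring
      rw [hlin, h1, Polynomial.resultant_C_mul_left,
        Polynomial.resultant_X_sub_C_left _ _ _ (natDegree_deh_le hG), eval_deh] at hres
      obtain ⟨Q, rfl⟩ := linForm_dvd_of_eval_eq_zero (a := 1) (b := b / a) (by simp) hG
        (by simpa [ha] using hres)
      rw [map_mul]
      have h2 : eval ![a, b] (linForm 1 (b / a)) = 0 := by
        simp [linForm, ha]
      rw [h2, zero_mul]

lemma bres_ne_zero [IsAlgClosed k] {F G : MvPolynomial (Fin 2) k} {d : ℕ} (hd : d ≠ 0)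
    (hF : F.IsHomogeneous d) (hG : G.IsHomogeneous d) (h : IsRelPrime F G) : bres d F G ≠ 0 := by
  rw [bres_eq_resultant hF hG]
  refine resultant_ne_zero_of_isRelPrime hG hF ?_ h.symm
  rintro rfl
  have hu : IsUnit F := h dvd_rfl (dvd_zero _)
  have h1 := hF.totalDegree hu.ne_zero
  rw [MvPolynomial.isUnit_iff_totalDegree_of_isReduced] at hu
  omega

end Composition

section Stability

/-- The numerical criterion in `Semistable`, for an arbitrary pair of binary forms. -/
def SemistablePair {S : Type*} [CommRing S] (d : ℕ) (F G : MvPolynomial (Fin 2) S) : Prop :=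
  ∃ (A F0 G0 : MvPolynomial (Fin 2) S) (e : ℕ),
    e ≤ d ∧ A.IsHomogeneous (d - e) ∧ F0.IsHomogeneous e ∧ G0.IsHomogeneous e ∧
    F = A * F0 ∧ G = A * G0 ∧ IsRelPrime F0 G0 ∧
    ∀ (a b : S), ¬(a = 0 ∧ b = 0) → ∀ r : ℕ,
      (MvPolynomial.C b * X 0 - MvPolynomial.C a * X 1) ^ r ∣ A →
        2 * r ≤ d + 1 ∧
          (d ≤ 2 * r →
            b * MvPolynomial.eval ![a, b] F0 ≠ a * MvPolynomial.eval ![a, b] G0)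

/-- The vanishing of the coefficients of nonnegative weight for the diagonal one-parameter
subgroup. -/
def DiagUnstable {S : Type*} [CommRing S] (d : ℕ)
    (P : MvPolynomial (Fin 2) S × MvPolynomial (Fin 2) S) : Prop :=
  (∀ i, i ≤ d → i < (d + 1) / 2 → cf d P.1 i = 0) ∧
    (∀ i, i ≤ d → i < (d + 1) / 2 + 1 → cf d P.2 i = 0)

variable {k : Type*} [Field k]

lemma diagUnstable_adjConj_iff {d : ℕ} {F G : MvPolynomial (Fin 2) k}
    (hF : F.IsHomogeneous d) (hG : G.IsHomogeneous d)
    {N : Matrix (Fin 2) (Fin 2) k} (hN : N.det ≠ 0) :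
    DiagUnstable d (adjConj N (F, G)) ↔
      linForm (N 0 0) (N 1 0) ^ ((d + 1) / 2) ∣ F ∧
      linForm (N 0 0) (N 1 0) ^ ((d + 1) / 2) ∣ G ∧
      linForm (N 0 0) (N 1 0) ^ ((d + 1) / 2 + 1) ∣ C (N 1 0) * F - C (N 0 0) * G := by
  have hu : IsUnit (C N.det : MvPolynomial (Fin 2) k) := (isUnit_iff_ne_zero.2 hN).map C
  have hdet : (C N.det : MvPolynomial (Fin 2) k) =
      C (N 0 0) * C (N 1 1) - C (N 0 1) * C (N 1 0) := by
    simp [Matrix.det_fin_two]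
  have hh := isHomogeneous_adjConj N (P := (F, G)) hF hG
  rw [DiagUnstable, ← X_one_pow_dvd_iff hh.1, ← X_one_pow_dvd_iff hh.2, linForm_pow_dvd_iff hN,
    linForm_pow_dvd_iff hN, linForm_pow_dvd_iff hN]
  have h2 : linSubst N (C (N 1 0) * F - C (N 0 0) * G) = -(adjConj N (F, G)).2 := by
    simp [adjConj]
  rw [h2, dvd_neg]
  have hFe : C N.det * linSubst N F =
      C (N 0 0) * (adjConj N (F, G)).1 + C (N 0 1) * (adjConj N (F, G)).2 := by
    simp only [adjConj, hdet]; ring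
  have hGe : C N.det * linSubst N G =
      C (N 1 0) * (adjConj N (F, G)).1 + C (N 1 1) * (adjConj N (F, G)).2 := by
    simp only [adjConj, hdet]; ring
  constructor
  · rintro ⟨h3, h4⟩
    have h5 := (pow_dvd_pow (X 1 : MvPolynomial (Fin 2) k) (Nat.le_succ _)).trans h4
    refine ⟨?_, ?_, h4⟩
    · rw [← hu.dvd_mul_left, hFe]
      exact dvd_add (h3.mul_left _) (h5.mul_left _)
    · rw [← hu.dvd_mul_left, hGe]
      exact dvd_add (h3.mul_left _) (h5.mul_left _)
  · rintro ⟨h3, h4, h5⟩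
    exact ⟨dvd_sub (h3.mul_left _) (h4.mul_left _), h5⟩

lemma SemistablePair.not_diagUnstable {d : ℕ} {F G : MvPolynomial (Fin 2) k}
    (hF : F.IsHomogeneous d) (hG : G.IsHomogeneous d) (h : SemistablePair d F G)
    {N : Matrix (Fin 2) (Fin 2) k} (hN : N.det ≠ 0) : ¬ DiagUnstable d (adjConj N (F, G)) := by
  obtain ⟨A, F0, G0, e, -, -, hF0, hG0, rfl, rfl, hrel, hA⟩ := h
  rw [diagUnstable_adjConj_iff hF hG hN]
  rintro ⟨h1, h2, h3⟩
  have hab : ¬(N 0 0 = 0 ∧ N 1 0 = 0) := fun h => hN (by simp [Matrix.det_fin_two, h.1, h.2])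
  have hp := prime_linForm hab
  obtain ⟨A', rfl⟩ := hrel.dvd_of_dvd_mul_of_dvd_mul h1 h2
  have h4 : linForm (N 0 0) (N 1 0) ∣ A' * (C (N 1 0) * F0 - C (N 0 0) * G0) := by
    rw [← mul_dvd_mul_iff_left (pow_ne_zero ((d + 1) / 2) hp.ne_zero), ← pow_succ]
    convert h3 using 1
    ring
  obtain h5 | h5 := hp.dvd_or_dvd h4
  · have := (hA _ _ hab ((d + 1) / 2 + 1) (by
      rw [pow_succ]; exact mul_dvd_mul_left _ h5)).1
    omega
  · refine (hA _ _ hab ((d + 1) / 2) (dvd_mul_right _ _)).2 (by omega) ?_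
    have := map_dvd (eval ![N 0 0, N 1 0]) h5
    rw [eval_linForm_self, zero_dvd_iff] at this
    simpa [sub_eq_zero] using this

lemma exists_diagUnstable_of_not_semistablePair {d : ℕ} {F G : MvPolynomial (Fin 2) k}
    (hF : F.IsHomogeneous d) (hG : G.IsHomogeneous d) (h0 : F ≠ 0 ∨ G ≠ 0)
    (h : ¬ SemistablePair d F G) :
    ∃ N : Matrix (Fin 2) (Fin 2) k, N.det ≠ 0 ∧ DiagUnstable d (adjConj N (F, G)) := by
  obtain ⟨F0, G0, A, hrel, rfl, rfl⟩ : ∃ F0 G0 A, IsRelPrime F0 G0 ∧ A * F0 = F ∧ A * G0 = G := by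
    obtain h0 | h0 := h0
    · exact UniqueFactorizationMonoid.exists_reduced_factors F h0 G
    · exact UniqueFactorizationMonoid.exists_reduced_factors' F G h0
  obtain ⟨j, e, hA, hF0, hG0, hje⟩ : ∃ j e, A.IsHomogeneous j ∧ F0.IsHomogeneous e ∧
      G0.IsHomogeneous e ∧ j + e = d := by
    have hA0 : A ≠ 0 := by rintro rfl; simp at h0
    by_cases hF' : F0 = 0
    · subst hF'
      have hG' : A * G0 ≠ 0 := by simpa using h0
      obtain ⟨i, j, h1, h2, h3⟩ := hG.exists_of_mul hG'
      exact ⟨i, j, h1, isHomogeneous_zero _ _ _, h2, h3⟩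
    · obtain ⟨i, j, h1, h2, h3⟩ := hF.exists_of_mul (mul_ne_zero hA0 hF')
      by_cases hG' : G0 = 0
      · subst hG'
        exact ⟨i, j, h1, h2, isHomogeneous_zero _ _ _, h3⟩
      · obtain ⟨i', j', h1', h2', h3'⟩ := hG.exists_of_mul (mul_ne_zero hA0 hG')
        obtain rfl := h1.inj_right h1' hA0
        obtain rfl : j = j' := by omega
        exact ⟨i, j, h1, h2, h2', h3⟩
  by_contra hcon
  push Not at hcon
  refine h ⟨A, F0, G0, e, by omega, by rwa [show d - e = j by omega], hF0, hG0, rfl, rfl, hrel, ?_⟩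
  intro a b hab r hr
  obtain ⟨N, rfl, rfl, hN⟩ := exists_matrix_first_column hab
  have hN' := hcon N hN
  rw [diagUnstable_adjConj_iff hF hG hN] at hN'
  change linForm (N 0 0) (N 1 0) ^ r ∣ A at hr
  have key : ∀ s, s ≤ r → linForm (N 0 0) (N 1 0) ^ s ∣ A := fun s hs => (pow_dvd_pow _ hs).trans hr
  constructor
  · by_contra hlt
    have h1 := key ((d + 1) / 2) (by omega)
    have h2 := key ((d + 1) / 2 + 1) (by omega)
    exact hN' ⟨h1.mul_right _, h1.mul_right _,
      dvd_sub ((h2.mul_right _).mul_left _) ((h2.mul_right _).mul_left _)⟩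
  · intro hdr heq
    have h1 := key ((d + 1) / 2) (by omega)
    refine hN' ⟨h1.mul_right _, h1.mul_right _, ?_⟩
    have h2 : linForm (N 0 0) (N 1 0) ∣ C (N 1 0) * F0 - C (N 0 0) * G0 :=
      linForm_dvd_of_eval_eq_zero hab ((hF0.C_mul _).sub (hG0.C_mul _)) (by
        simpa [sub_eq_zero] using heq)
    convert mul_dvd_mul h1 h2 using 1 <;> ring

end Stability

section Reduction


/-- The residue map `O → k`. -/
def resMap : intRing K →+* kk K := Ideal.Quotient.mk (maxIdl K)

lemma resMap_surjective : Function.Surjective (resMap K) := Ideal.Quotient.mk_surjective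

variable {K}

lemma resMap_eq_zero_iff (x : intRing K) : resMap K x = 0 ↔ ‖(x : K)‖ < 1 :=
  Ideal.Quotient.eq_zero_iff_mem

lemma resMap_ne_zero_iff (x : intRing K) : resMap K x ≠ 0 ↔ ‖(x : K)‖ = 1 := by
  rw [Ne, resMap_eq_zero_iff, not_lt]
  exact ⟨fun h => le_antisymm x.2 h, fun h => h.ge⟩

lemma isField_kk : IsField (kk K) where
  exists_pair_ne := ⟨0, 1, fun h => by
    have := (resMap_eq_zero_iff (1 : intRing K)).1 (by rw [map_one, h])
    simp at this⟩
  mul_comm := mul_comm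
  mul_inv_cancel := by
    intro a ha
    obtain ⟨x, rfl⟩ := resMap_surjective K a
    have hx := (resMap_ne_zero_iff x).1 ha
    refine ⟨resMap K ⟨(x : K)⁻¹, ?_⟩, ?_⟩
    · change ‖(x : K)⁻¹‖ ≤ 1
      rw [norm_inv, hx, inv_one]
    · rw [← map_mul, ← map_one (resMap K)]
      congr 1
      ext
      exact mul_inv_cancel₀ (norm_ne_zero_iff.1 (by rw [hx]; exact one_ne_zero))

lemma exists_map_subtype_eq {F : MvPolynomial (Fin 2) K} (h : ∀ m, ‖F.coeff m‖ ≤ 1) :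
    ∃ F' : MvPolynomial (Fin 2) (intRing K), MvPolynomial.map (intRing K).subtype F' = F := by
  refine ⟨∑ m ∈ F.support, monomial m ⟨F.coeff m, h m⟩, ?_⟩
  rw [map_sum]
  simp only [map_monomial]
  exact F.support_sum_monomial_coeff

lemma redPoly_map_subtype (F' : MvPolynomial (Fin 2) (intRing K)) :
    redPoly K (MvPolynomial.map (intRing K).subtype F') = MvPolynomial.map (resMap K) F' := by
  have hinj : Function.Injective (intRing K).subtype := Subtype.coe_injective
  conv_rhs => rw [← F'.support_sum_monomial_coeff, map_sum]
  rw [redPoly, support_map_of_injective _ hinj]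
  refine Finset.sum_congr rfl fun m _ => ?_
  rw [map_monomial, coeff_map, redCoeff]
  exact congrArg _ (dif_pos (F'.coeff m).2)

lemma exists_map_eq_of_norm_le {U : Matrix (Fin 2) (Fin 2) K} (h : ∀ i j, ‖U i j‖ ≤ 1) :
    ∃ U' : Matrix (Fin 2) (Fin 2) (intRing K), U'.map (intRing K).subtype = U :=
  ⟨Matrix.of fun i j => ⟨U i j, h i j⟩, rfl⟩

lemma det_map_eq {S T : Type*} [CommRing S] [CommRing T] (φ : S →+* T)
    (U : Matrix (Fin 2) (Fin 2) S) : (U.map φ).det = φ U.det :=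
  (RingHom.map_det φ U).symm

lemma IsField.not_diagUnstable {S : Type*} [CommRing S] (hS : IsField S) {d : ℕ}
    {F G : MvPolynomial (Fin 2) S} (hF : F.IsHomogeneous d) (hG : G.IsHomogeneous d)
    (h : SemistablePair d F G) {N : Matrix (Fin 2) (Fin 2) S} (hN : N.det ≠ 0) :
    ¬ DiagUnstable d (adjConj N (F, G)) :=
  letI := hS.toField
  SemistablePair.not_diagUnstable hF hG h hN

lemma IsField.exists_diagUnstable {S : Type*} [CommRing S] (hS : IsField S) {d : ℕ}
    {F G : MvPolynomial (Fin 2) S} (hF : F.IsHomogeneous d) (hG : G.IsHomogeneous d)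
    (h0 : F ≠ 0 ∨ G ≠ 0) (h : ¬ SemistablePair d F G) :
    ∃ N : Matrix (Fin 2) (Fin 2) S, N.det ≠ 0 ∧ DiagUnstable d (adjConj N (F, G)) :=
  letI := hS.toField
  exists_diagUnstable_of_not_semistablePair hF hG h0 h

lemma cf_adjConj_map {S T : Type*} [CommRing S] [CommRing T] (φ : S →+* T)
    (U : Matrix (Fin 2) (Fin 2) S) (F G : MvPolynomial (Fin 2) S) (d i : ℕ) :
    cf d (adjConj (U.map φ) (MvPolynomial.map φ F, MvPolynomial.map φ G)).1 i =
      φ (cf d (adjConj U (F, G)).1 i) ∧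
    cf d (adjConj (U.map φ) (MvPolynomial.map φ F, MvPolynomial.map φ G)).2 i =
      φ (cf d (adjConj U (F, G)).2 i) := by
  rw [map_adjConj]
  exact ⟨coeff_map _ _ _, coeff_map _ _ _⟩

lemma Semistable.exists_norm_eq_one {d : ℕ} {F G : MvPolynomial (Fin 2) K}
    (hF : F.IsHomogeneous d) (hG : G.IsHomogeneous d) (hF1 : ∀ m, ‖F.coeff m‖ ≤ 1)
    (hG1 : ∀ m, ‖G.coeff m‖ ≤ 1) (h : Semistable K d F G)
    {U : Matrix (Fin 2) (Fin 2) K} (hU : ∀ i j, ‖U i j‖ ≤ 1) (hdet : ‖U.det‖ = 1) :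
    ∃ i, i ≤ d ∧ ((i < (d + 1) / 2 ∧ ‖cf d (adjConj U (F, G)).1 i‖ = 1) ∨
      (i < (d + 1) / 2 + 1 ∧ ‖cf d (adjConj U (F, G)).2 i‖ = 1)) := by
  obtain ⟨F', rfl⟩ := exists_map_subtype_eq hF1
  obtain ⟨G', rfl⟩ := exists_map_subtype_eq hG1
  obtain ⟨U', rfl⟩ := exists_map_eq_of_norm_le hU
  have hinj : Function.Injective (intRing K).subtype := Subtype.coe_injective
  have hd : (U'.map (resMap K)).det ≠ 0 := by
    rw [det_map_eq, resMap_ne_zero_iff]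
    rwa [det_map_eq] at hdet
  have h' : SemistablePair d (MvPolynomial.map (resMap K) F') (MvPolynomial.map (resMap K) G') := by
    rw [← redPoly_map_subtype, ← redPoly_map_subtype]
    exact h
  have hns := isField_kk.not_diagUnstable ((hF.of_map hinj).map _) ((hG.of_map hinj).map _) h' hd
  by_contra! hcon
  refine hns ⟨fun i hi his => ?_, fun i hi his => ?_⟩
  · rw [(cf_adjConj_map _ _ _ _ _ _).1]
    by_contra hne
    refine (hcon i hi).1 his ?_
    rw [(cf_adjConj_map _ _ _ _ _ _).1]
    exact (resMap_ne_zero_iff _).1 hne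
  · rw [(cf_adjConj_map _ _ _ _ _ _).2]
    by_contra hne
    refine (hcon i hi).2 his ?_
    rw [(cf_adjConj_map _ _ _ _ _ _).2]
    exact (resMap_ne_zero_iff _).1 hne

lemma Normalized.exists_norm_lt_one {d : ℕ} {F G : MvPolynomial (Fin 2) K}
    (hF : F.IsHomogeneous d) (hG : G.IsHomogeneous d) (hn : Normalized K F G)
    (h : ¬ Semistable K d F G) :
    ∃ U : Matrix (Fin 2) (Fin 2) K, (∀ i j, ‖U i j‖ ≤ 1) ∧ ‖U.det‖ = 1 ∧
      ∀ i, i ≤ d → ((i < (d + 1) / 2 → ‖cf d (adjConj U (F, G)).1 i‖ < 1) ∧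
        (i < (d + 1) / 2 + 1 → ‖cf d (adjConj U (F, G)).2 i‖ < 1)) := by
  obtain ⟨hF1, hG1, m, hm⟩ := hn
  obtain ⟨F', rfl⟩ := exists_map_subtype_eq hF1
  obtain ⟨G', rfl⟩ := exists_map_subtype_eq hG1
  have hinj : Function.Injective (intRing K).subtype := Subtype.coe_injective
  have h' : ¬ SemistablePair d (MvPolynomial.map (resMap K) F')
      (MvPolynomial.map (resMap K) G') := by
    rw [← redPoly_map_subtype, ← redPoly_map_subtype]
    exact h
  have h0 : MvPolynomial.map (resMap K) F' ≠ 0 ∨ MvPolynomial.map (resMap K) G' ≠ 0 := by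
    refine hm.imp (fun h h0 => ?_) (fun h h0 => ?_) <;>
    · have h1 := congrArg (coeff m) h0
      rw [coeff_map, coeff_zero] at h1
      rw [coeff_map] at h
      exact (resMap_ne_zero_iff _).2 h h1
  obtain ⟨N, hN, hNd⟩ := isField_kk.exists_diagUnstable ((hF.of_map hinj).map _)
    ((hG.of_map hinj).map _) h0 h'
  obtain ⟨U, rfl⟩ : ∃ U : Matrix (Fin 2) (Fin 2) (intRing K), U.map (resMap K) = N := by
    choose U hU using fun i j => resMap_surjective K (N i j)
    exact ⟨Matrix.of U, by ext i j; exact hU i j⟩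
  refine ⟨U.map (intRing K).subtype, fun i j => (U i j).2, ?_, fun i hi => ⟨fun his => ?_,
    fun his => ?_⟩⟩
  · rw [det_map_eq] at hN ⊢
    exact (resMap_ne_zero_iff _).1 hN
  · rw [(cf_adjConj_map _ _ _ _ _ _).1]
    refine (resMap_eq_zero_iff _).1 ?_
    rw [← (cf_adjConj_map _ _ _ _ _ _).1]
    exact hNd.1 i hi his
  · rw [(cf_adjConj_map _ _ _ _ _ _).2]
    refine (resMap_eq_zero_iff _).1 ?_
    rw [← (cf_adjConj_map _ _ _ _ _ _).2]
    exact hNd.2 i hi his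

end Reduction

section Norms

variable {K}

lemma norm_cf_le_maxNorm {K : Type} [NontriviallyNormedField K]
    {e i : ℕ} (hi : i ≤ e) (F G : MvPolynomial (Fin 2) K) :
    ‖cf e F i‖ ≤ maxNorm K e F G ∧ ‖cf e G i‖ ≤ maxNorm K e F G := by
  have h := Finset.le_sup' (fun i : Fin (e + 1) => max ‖coeffVec e F i‖ ‖coeffVec e G i‖)
    (Finset.mem_univ ⟨i, Nat.lt_succ_of_le hi⟩)
  exact max_le_iff.1 h

lemma exists_norm_cf_eq_maxNorm {K : Type} [NontriviallyNormedField K]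
    (e : ℕ) (F G : MvPolynomial (Fin 2) K) :
    ∃ i, i ≤ e ∧ (maxNorm K e F G = ‖cf e F i‖ ∨ maxNorm K e F G = ‖cf e G i‖) := by
  obtain ⟨i, -, hi⟩ := Finset.exists_mem_eq_sup' Finset.univ_nonempty
    (fun i : Fin (e + 1) => max ‖coeffVec e F i‖ ‖coeffVec e G i‖)
  refine ⟨i, Nat.lt_succ_iff.1 i.2, ?_⟩
  rcases max_choice ‖coeffVec e F i‖ ‖coeffVec e G i‖ with h | h
  · exact Or.inl (hi.trans h)
  · exact Or.inr (hi.trans h)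

lemma maxNorm_le_iff {K : Type} [NontriviallyNormedField K]
    {e : ℕ} {F G : MvPolynomial (Fin 2) K} {B : ℝ} :
    maxNorm K e F G ≤ B ↔ ∀ i, i ≤ e → ‖cf e F i‖ ≤ B ∧ ‖cf e G i‖ ≤ B := by
  constructor
  · exact fun h i hi => (norm_cf_le_maxNorm hi F G).imp h.trans' h.trans'
  · intro h
    obtain ⟨i, hi, h1 | h1⟩ := exists_norm_cf_eq_maxNorm e F G
    · exact h1.trans_le (h i hi).1
    · exact h1.trans_le (h i hi).2

lemma maxNorm_nonneg {K : Type} [NontriviallyNormedField K]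
    (e : ℕ) (F G : MvPolynomial (Fin 2) K) : 0 ≤ maxNorm K e F G :=
  (norm_nonneg _).trans (norm_cf_le_maxNorm (Nat.zero_le e) F G).1

lemma norm_coeff_le_of_cf {K : Type} [NontriviallyNormedField K]
    {e : ℕ} {F : MvPolynomial (Fin 2) K} (hF : F.IsHomogeneous e) {B : ℝ}
    (hB : 0 ≤ B) (h : ∀ i, i ≤ e → ‖cf e F i‖ ≤ B) (m : Fin 2 →₀ ℕ) : ‖F.coeff m‖ ≤ B := by
  by_cases hm : m.degree = e
  · obtain ⟨h1, h2⟩ := exponent_eq hm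
    rw [h1]
    exact h _ h2
  · rw [hF.coeff_eq_zero hm, norm_zero]
    exact hB

lemma maxNorm_C_mul {K : Type} [NontriviallyNormedField K]
    (c : K) (e : ℕ) (F G : MvPolynomial (Fin 2) K) :
    maxNorm K e (C c * F) (C c * G) = ‖c‖ * maxNorm K e F G := by
  have h : ∀ (F : MvPolynomial (Fin 2) K) i, ‖cf e (C c * F) i‖ = ‖c‖ * ‖cf e F i‖ := by
    intro F i
    rw [cf, coeff_C_mul, norm_mul, cf]
  apply le_antisymm
  · rw [maxNorm_le_iff]
    intro i hi
    rw [h, h]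
    exact (norm_cf_le_maxNorm hi F G).imp (fun h => by gcongr) (fun h => by gcongr)
  · obtain ⟨i, hi, h1 | h1⟩ := exists_norm_cf_eq_maxNorm e F G
    · rw [h1, ← h]
      exact (norm_cf_le_maxNorm hi _ _).1
    · rw [h1, ← h]
      exact (norm_cf_le_maxNorm hi _ _).2

lemma norm_coeff_linSubst_le {V : Matrix (Fin 2) (Fin 2) K} (hV : ∀ i j, ‖V i j‖ ≤ 1)
    {F : MvPolynomial (Fin 2) K} {B : ℝ} (hB : 0 ≤ B) (h : ∀ m, ‖F.coeff m‖ ≤ B)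
    (n : Fin 2 →₀ ℕ) : ‖(linSubst V F).coeff n‖ ≤ B := by
  obtain ⟨V, rfl⟩ := exists_map_eq_of_norm_le hV
  conv_lhs => rw [← F.support_sum_monomial_coeff, map_sum, coeff_sum]
  refine IsUltrametricDist.norm_sum_le_of_forall_le_of_nonneg hB fun m _ => ?_
  have h1 : monomial m (F.coeff m) =
      C (F.coeff m) * MvPolynomial.map (intRing K).subtype (monomial m 1) := by
    rw [map_monomial, map_one, C_mul_monomial, mul_one]
  rw [h1, map_mul, linSubst_C, coeff_C_mul, ← map_linSubst, coeff_map, norm_mul]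
  exact (mul_le_of_le_one_right (norm_nonneg _)
    (coeff n (linSubst V (monomial m 1))).2).trans (h m)

lemma norm_coeff_adjConj_le {V : Matrix (Fin 2) (Fin 2) K} (hV : ∀ i j, ‖V i j‖ ≤ 1)
    {P : MvPolynomial (Fin 2) K × MvPolynomial (Fin 2) K} {B : ℝ} (hB : 0 ≤ B)
    (h₁ : ∀ m, ‖P.1.coeff m‖ ≤ B) (h₂ : ∀ m, ‖P.2.coeff m‖ ≤ B) (n : Fin 2 →₀ ℕ) :
    ‖(adjConj V P).1.coeff n‖ ≤ B ∧ ‖(adjConj V P).2.coeff n‖ ≤ B := by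
  have key : ∀ (a b x y : K), ‖a‖ ≤ 1 → ‖b‖ ≤ 1 → ‖x‖ ≤ B → ‖y‖ ≤ B → ‖a * x - b * y‖ ≤ B := by
    intro a b x y ha hb hx hy
    rw [sub_eq_add_neg]
    refine (IsUltrametricDist.norm_add_le_max _ _).trans (max_le ?_ ?_)
    · rw [norm_mul]
      exact (mul_le_of_le_one_left (norm_nonneg _) ha).trans hx
    · rw [norm_neg, norm_mul]
      exact (mul_le_of_le_one_left (norm_nonneg _) hb).trans hy
  have e₁ := norm_coeff_linSubst_le hV hB h₁ n
  have e₂ := norm_coeff_linSubst_le hV hB h₂ n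
  simp only [adjConj, coeff_sub, coeff_C_mul]
  exact ⟨key _ _ _ _ (hV 1 1) (hV 0 1) e₁ e₂, key _ _ _ _ (hV 0 0) (hV 1 0) e₂ e₁⟩

lemma maxNorm_adjConj_le {V : Matrix (Fin 2) (Fin 2) K} (hV : ∀ i j, ‖V i j‖ ≤ 1) {e : ℕ}
    {P : MvPolynomial (Fin 2) K × MvPolynomial (Fin 2) K} (h₁ : P.1.IsHomogeneous e)
    (h₂ : P.2.IsHomogeneous e) :
    maxNorm K e (adjConj V P).1 (adjConj V P).2 ≤ maxNorm K e P.1 P.2 := by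
  rw [maxNorm_le_iff]
  exact fun i _ => norm_coeff_adjConj_le hV (maxNorm_nonneg _ _ _)
    (norm_coeff_le_of_cf h₁ (maxNorm_nonneg _ _ _) fun i hi => (norm_cf_le_maxNorm hi _ _).1)
    (norm_coeff_le_of_cf h₂ (maxNorm_nonneg _ _ _) fun i hi => (norm_cf_le_maxNorm hi _ _).2) _

lemma norm_det_le {n : ℕ} {A : Matrix (Fin n) (Fin n) K} {B : ℝ} (hB : 0 ≤ B)
    (h : ∀ i j, ‖A i j‖ ≤ B) : ‖A.det‖ ≤ B ^ n := by
  rw [Matrix.det_apply]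
  refine IsUltrametricDist.norm_sum_le_of_forall_le_of_nonneg (pow_nonneg hB _) fun σ _ => ?_
  have hs : ‖(Equiv.Perm.sign σ • ∏ i, A (σ i) i : K)‖ = ∏ i, ‖A (σ i) i‖ := by
    rw [← norm_prod]
    rcases Int.units_eq_one_or (Equiv.Perm.sign σ) with h | h <;> simp [h]
  rw [hs]
  calc ∏ i, ‖A (σ i) i‖ ≤ ∏ _i : Fin n, B :=
        Finset.prod_le_prod (fun _ _ => norm_nonneg _) fun _ _ => h _ _
    _ = B ^ n := by simp

lemma norm_bres_le (e : ℕ) (F G : MvPolynomial (Fin 2) K) :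
    ‖bres e F G‖ ≤ maxNorm K e F G ^ (2 * e) := by
  rw [two_mul]
  refine norm_det_le (maxNorm_nonneg _ _ _) fun i j => ?_
  rw [sylv, Matrix.of_apply]
  split_ifs with h h1 h1
  · exact (norm_cf_le_maxNorm (by simp; omega) F G).1
  · simpa using maxNorm_nonneg _ _ _
  · exact (norm_cf_le_maxNorm (by simp; omega) F G).2
  · simpa using maxNorm_nonneg _ _ _

lemma maxNorm_pos {e : ℕ} (he : e ≠ 0) {F G : MvPolynomial (Fin 2) K} (h : bres e F G ≠ 0) :
    0 < maxNorm K e F G := by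
  refine (maxNorm_nonneg e F G).lt_of_ne' fun h0 => ?_
  have h1 := norm_bres_le e F G
  rw [h0, zero_pow (by omega)] at h1
  exact h (norm_le_zero_iff.1 h1)

lemma Rpair_nonneg {e : ℕ} {F G : MvPolynomial (Fin 2) K} (h : bres e F G ≠ 0) :
    0 ≤ Rpair K e F G := by
  have h1 := Real.log_le_log (norm_pos_iff.2 h) (norm_bres_le e F G)
  rw [Real.log_pow] at h1
  push_cast at h1
  rw [Rpair, ordv]
  linarith

lemma conjPair_eq {K : Type} [NontriviallyNormedField K]
    (M : GL (Fin 2) K) (F G : MvPolynomial (Fin 2) K) :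
    conjPair K M F G =
      (C (M : Matrix (Fin 2) (Fin 2) K).det⁻¹ *
          (adjConj (M : Matrix (Fin 2) (Fin 2) K) (F, G)).1,
        C (M : Matrix (Fin 2) (Fin 2) K).det⁻¹ *
          (adjConj (M : Matrix (Fin 2) (Fin 2) K) (F, G)).2) := by
  have hm : ∀ F, mobius K M F = linSubst (M : Matrix (Fin 2) (Fin 2) K) F := fun _ => rfl
  simp only [conjPair, Matrix.coe_units_inv, Matrix.inv_def, Matrix.adjugate_fin_two, hm, adjConj,
    Ring.inverse_eq_inv', Matrix.smul_apply, Matrix.of_apply, Matrix.cons_val',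
    Matrix.cons_val_zero, Matrix.cons_val_fin_one, Matrix.cons_val_one, smul_eq_mul, map_mul, map_neg]
  ext1 <;> simp only <;> ring

end Norms

section ResultantVariation

variable {K}

lemma Rpair_conjPair {K : Type} [NontriviallyNormedField K] [IsAlgClosed K]
    {e : ℕ} {F G : MvPolynomial (Fin 2) K} (hF : F.IsHomogeneous e)
    (hG : G.IsHomogeneous e) (h0 : bres e F G ≠ 0) (M : GL (Fin 2) K)
    (hpos : 0 < maxNorm K e (adjConj (M : Matrix (Fin 2) (Fin 2) K) (F, G)).1
      (adjConj (M : Matrix (Fin 2) (Fin 2) K) (F, G)).2) :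
    Rpair K e (conjPair K M F G).1 (conjPair K M F G).2 = ordv K (bres e F G) +
      e * (Real.log (maxNorm K e (adjConj (M : Matrix (Fin 2) (Fin 2) K) (F, G)).1
        (adjConj (M : Matrix (Fin 2) (Fin 2) K) (F, G)).2 ^ 2) -
        Real.log (‖(M : Matrix (Fin 2) (Fin 2) K).det‖ ^ (e + 1))) := by
  have hM : (M : Matrix (Fin 2) (Fin 2) K).det ≠ 0 := M.isUnit.map Matrix.detMonoidHom |>.ne_zero
  have hM' := norm_ne_zero_iff.2 hM
  have hb := norm_ne_zero_iff.2 h0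
  have hh := isHomogeneous_adjConj (M : Matrix (Fin 2) (Fin 2) K) (P := (F, G)) hF hG
  rw [conjPair_eq, Rpair, bres_C_mul _ hh.1 hh.2, bres_adjConj hF hG, maxNorm_C_mul, ordv, ordv,
    norm_mul, norm_mul, norm_pow, norm_pow, norm_inv,
    Real.log_mul (by positivity) (by positivity), Real.log_mul (by positivity) (by positivity),
    Real.log_mul (by positivity) (by positivity)]
  simp only [Real.log_pow, Real.log_inv]
  push_cast
  ring

lemma exists_mul_eq_mul_diagonal {M : Matrix (Fin 2) (Fin 2) K} (hM : M.det ≠ 0) :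
    ∃ (U V : Matrix (Fin 2) (Fin 2) K) (α δ : K), (∀ i j, ‖U i j‖ ≤ 1) ∧ (∀ i j, ‖V i j‖ ≤ 1) ∧
      ‖U.det‖ = 1 ∧ ‖V.det‖ = 1 ∧ ‖δ‖ ≤ ‖α‖ ∧ M * V = U * !![α, 0; 0, δ] := by
  have hne : ∃ i j, ∀ i' j', ‖M i' j'‖ ≤ ‖M i j‖ := by
    obtain ⟨p, hp⟩ := Finite.exists_max fun p : Fin 2 × Fin 2 => ‖M p.1 p.2‖
    exact ⟨p.1, p.2, fun i' j' => hp (i', j')⟩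
  obtain ⟨i, j, hij⟩ := hne
  have hα : M i j ≠ 0 := by
    intro h0
    simp only [h0, norm_zero, norm_le_zero_iff] at hij
    exact hM (by simp [Matrix.det_fin_two, hij])
  have hq : ∀ x, ‖x‖ ≤ ‖M i j‖ → ‖x / M i j‖ ≤ 1 := by
    intro x hx
    rw [norm_div]
    exact div_le_one_of_le₀ hx (norm_nonneg _)
  have hδ : ∀ x y z, ‖x‖ ≤ ‖M i j‖ → ‖y‖ ≤ ‖M i j‖ → ‖z‖ ≤ ‖M i j‖ →
      ‖x - y / M i j * z‖ ≤ ‖M i j‖ := by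
    intro x y z hx hy hz
    rw [sub_eq_add_neg]
    refine (IsUltrametricDist.norm_add_le_max _ _).trans (max_le hx ?_)
    rw [norm_neg, norm_mul]
    exact (mul_le_of_le_one_left (norm_nonneg _) (hq y hy)).trans hz
  obtain ⟨V, hV, hVd, hV0, hV1⟩ : ∃ V : Matrix (Fin 2) (Fin 2) K, (∀ i j, ‖V i j‖ ≤ 1) ∧
      ‖V.det‖ = 1 ∧ (∀ r, (M * V) r 0 = M r j) ∧
      ∀ r, (M * V) r 1 = M r (1 - j) - M i (1 - j) / M i j * M r j := by
    fin_cases j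
    · refine ⟨!![1, -(M i 1 / M i 0); 0, 1], ?_, ?_, ?_, ?_⟩
      · simpa [Fin.forall_fin_two] using hq _ (hij i 1)
      · simp [Matrix.det_fin_two_of]
      · simp [Matrix.mul_apply, Fin.sum_univ_two]
      · intro r
        simp [Matrix.mul_apply, Fin.sum_univ_two]
        ring
    · refine ⟨!![0, 1; 1, -(M i 0 / M i 1)], ?_, ?_, ?_, ?_⟩
      · simpa [Fin.forall_fin_two] using hq _ (hij i 0)
      · simp [Matrix.det_fin_two_of]
      · simp [Matrix.mul_apply, Fin.sum_univ_two]
      · intro r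
        simp [Matrix.mul_apply, Fin.sum_univ_two]
        ring
  have hi1 : (M * V) i 1 = 0 := by
    rw [hV1, div_mul_cancel₀ _ hα, sub_self]
  have hmul : ∀ U : Matrix (Fin 2) (Fin 2) K, (∀ r, U r 0 = M r j / M i j) → U i 1 = 0 →
      U (1 - i) 1 = 1 → M * V = U * !![M i j, 0; 0, (M * V) (1 - i) 1] := by
    intro U h0 h1 h2
    have hr : ∀ i r : Fin 2, r = i ∨ r = 1 - i := by decide
    ext r c
    fin_cases c
    · simp [hV0, Matrix.mul_apply, Fin.sum_univ_two, h0, hα]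
    · obtain rfl | rfl := hr i r <;> simp [Matrix.mul_apply (M := U), Fin.sum_univ_two, h1, h2, hi1]
  have hδ' : ‖(M * V) (1 - i) 1‖ ≤ ‖M i j‖ := by
    rw [hV1]
    exact hδ _ _ _ (hij _ _) (hij _ _) (hij _ _)
  have hc := hq _ (hij (1 - i) j)
  fin_cases i
  · refine ⟨!![1, 0; M 1 j / M 0 j, 1], V, M 0 j, _, ?_, hV, ?_, hVd, hδ', hmul _ ?_ ?_ ?_⟩
    · simpa [Fin.forall_fin_two] using hc
    · simp [Matrix.det_fin_two_of]
    · simpa [Fin.forall_fin_two] using (div_self hα).symm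
    · rfl
    · rfl
  · refine ⟨!![M 0 j / M 1 j, 1; 1, 0], V, M 1 j, _, ?_, hV, ?_, hVd, hδ', hmul _ ?_ ?_ ?_⟩
    · simpa [Fin.forall_fin_two] using hc
    · simp [Matrix.det_fin_two_of]
    · simpa [Fin.forall_fin_two] using (div_self hα).symm
    · rfl
    · rfl

lemma mul_pow_le_sq {a b : ℝ} (hb : 0 ≤ b) (hab : b ≤ a) {j N : ℕ} (h : 2 * j ≤ N) :
    (a * b) ^ N ≤ (a ^ (N - j) * b ^ j) ^ 2 := by
  obtain ⟨t, rfl⟩ := Nat.exists_eq_add_of_le h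
  rw [show 2 * j + t - j = j + t by omega]
  have h1 : b ^ t ≤ a ^ t := by gcongr
  have ha : 0 ≤ a := hb.trans hab
  calc (a * b) ^ (2 * j + t) = a ^ (2 * j + t) * b ^ (2 * j) * b ^ t := by ring
    _ ≤ a ^ (2 * j + t) * b ^ (2 * j) * a ^ t := by gcongr
    _ = _ := by ring

lemma Semistable.det_pow_le_maxNorm_sq {e : ℕ} {F G : MvPolynomial (Fin 2) K}
    (hF : F.IsHomogeneous e) (hG : G.IsHomogeneous e) (hn : Normalized K F G)
    (hs : Semistable K e F G) {M : Matrix (Fin 2) (Fin 2) K} (hM : M.det ≠ 0) :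
    ‖M.det‖ ^ (e + 1) ≤ maxNorm K e (adjConj M (F, G)).1 (adjConj M (F, G)).2 ^ 2 := by
  obtain ⟨U, V, α, δ, hU, hV, hUd, hVd, hδ, hMV⟩ := exists_mul_eq_mul_diagonal hM
  have hdet : ‖M.det‖ = ‖α‖ * ‖δ‖ := by
    have := congrArg (fun A => ‖A.det‖) hMV
    simpa [Matrix.det_mul, hUd, hVd, Matrix.det_fin_two_of] using this
  have hh := isHomogeneous_adjConj M (P := (F, G)) hF hG
  have h1 := maxNorm_adjConj_le hV hh.1 hh.2
  rw [← adjConj_mul, hMV, adjConj_mul] at h1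
  obtain ⟨i, hi, h2⟩ := hs.exists_norm_eq_one hF hG hn.1 hn.2.1 hU hUd
  rw [hdet]
  have h3 := norm_cf_le_maxNorm hi (adjConj !![α, 0; 0, δ] (adjConj U (F, G))).1
    (adjConj !![α, 0; 0, δ] (adjConj U (F, G))).2
  rw [(cf_adjConj_diagonal _ _ _ _ _).1, (cf_adjConj_diagonal _ _ _ _ _).2] at h3
  simp only [norm_mul, norm_pow] at h3
  obtain ⟨his, h2⟩ | ⟨his, h2⟩ := h2
  · refine (mul_pow_le_sq (norm_nonneg _) hδ (j := i + 1) (by omega)).trans ?_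
    have h4 := h3.1.trans h1
    rw [h2, mul_one] at h4
    rw [show e + 1 - (i + 1) = e - i by omega]
    gcongr
  · refine (mul_pow_le_sq (norm_nonneg _) hδ (j := i) (by omega)).trans ?_
    have h4 := h3.2.trans h1
    rw [h2, mul_one] at h4
    rw [show e + 1 - i = e - i + 1 by omega]
    gcongr

lemma Semistable.ordv_bres_le_Rpair [IsAlgClosed K] {e : ℕ} (he : e ≠ 0)
    {F G : MvPolynomial (Fin 2) K}
    (hF : F.IsHomogeneous e) (hG : G.IsHomogeneous e) (h0 : bres e F G ≠ 0)
    (hn : Normalized K F G) (hs : Semistable K e F G) (M : GL (Fin 2) K) :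
    ordv K (bres e F G) ≤ Rpair K e (conjPair K M F G).1 (conjPair K M F G).2 := by
  have hM : (M : Matrix (Fin 2) (Fin 2) K).det ≠ 0 := M.isUnit.map Matrix.detMonoidHom |>.ne_zero
  have hM' := norm_pos_iff.2 hM
  rw [Rpair_conjPair hF hG h0 M (maxNorm_pos he ?_)]
  · have := Real.log_le_log (by positivity) (hs.det_pow_le_maxNorm_sq hF hG hn hM)
    have := mul_nonneg (Nat.cast_nonneg (α := ℝ) e) (sub_nonneg.2 this)
    linarith
  · rw [bres_adjConj hF hG]
    exact mul_ne_zero (pow_ne_zero _ hM) h0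

lemma exists_norm_lt_one_forall_lt_pow {K : Type} [NontriviallyNormedField K] [IsAlgClosed K]
    {ι : Type*} [Finite ι] (x : ι → ℝ)
    (hx0 : ∀ i, 0 ≤ x i) (N : ℕ) :
    ∃ t : K, 0 < ‖t‖ ∧ ‖t‖ < 1 ∧ ∀ i, x i < 1 → x i < ‖t‖ ^ N := by
  obtain ⟨π, hπ0, hπ1⟩ := NormedField.exists_norm_lt_one K
  have h1 : ∀ i, ∀ᶠ n in Filter.atTop, x i < 1 → x i ^ n < ‖π‖ ^ N := by
    intro i
    by_cases hi : x i < 1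
    · filter_upwards [(tendsto_pow_atTop_nhds_zero_of_lt_one (hx0 i) hi).eventually_lt_const
        (pow_pos hπ0 N)] with n hn _ using hn
    · simp [hi]
  obtain ⟨n, hn, hn0⟩ := ((Filter.eventually_all.2 h1).and (Filter.eventually_gt_atTop 0)).exists
  obtain ⟨t, ht⟩ := IsAlgClosed.exists_pow_nat_eq π hn0
  have ht' : ‖t‖ ^ n = ‖π‖ := by rw [← norm_pow, ht]
  refine ⟨t, ?_, ?_, fun i hi => ?_⟩
  · rw [norm_pos_iff]
    rintro rfl
    rw [norm_zero, zero_pow hn0.ne'] at ht'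
    exact hπ0.ne ht'
  · rw [← pow_lt_one_iff_of_nonneg (norm_nonneg t) hn0.ne', ht']
    exact hπ1
  · refine lt_of_pow_lt_pow_left₀ n (by positivity) ?_
    rw [← pow_mul, mul_comm, pow_mul, ht']
    exact hn i hi

lemma Normalized.exists_Rpair_lt [IsAlgClosed K] {e : ℕ} (he : e ≠ 0)
    {F G : MvPolynomial (Fin 2) K} (hF : F.IsHomogeneous e) (hG : G.IsHomogeneous e)
    (h0 : bres e F G ≠ 0) (hn : Normalized K F G) (hs : ¬ Semistable K e F G) :
    ∃ M : GL (Fin 2) K,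
      Rpair K e (conjPair K M F G).1 (conjPair K M F G).2 < ordv K (bres e F G) := by
  obtain ⟨U, hU, hUd, hcf⟩ := hn.exists_norm_lt_one hF hG hs
  set Q := adjConj U (F, G) with hQ
  have hQ1 := norm_coeff_adjConj_le hU zero_le_one (P := (F, G)) hn.1 hn.2.1
  obtain ⟨t, ht0, ht1, ht⟩ := exists_norm_lt_one_forall_lt_pow (K := K)
    (Sum.elim (fun i : Fin (e + 1) => ‖cf e Q.1 i‖ ^ 2)
      (fun i : Fin (e + 1) => ‖cf e Q.2 i‖ ^ 2)) (by rintro (i | i) <;> simp) (e + 1)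
  have key : ∀ {c : K} {j : ℕ}, ‖c‖ ≤ 1 → (‖c‖ ^ 2 < 1 → ‖c‖ ^ 2 < ‖t‖ ^ (e + 1)) →
      (2 * j ≤ e + 1 → ‖c‖ < 1) → ‖t ^ j * c‖ ^ 2 < ‖t‖ ^ (e + 1) := by
    intro c j hc hct hj
    rw [norm_mul, norm_pow, mul_pow]
    by_cases h : 2 * j ≤ e + 1
    · refine lt_of_le_of_lt (mul_le_of_le_one_left (by positivity) ?_)
        (hct (pow_lt_one₀ (norm_nonneg _) (hj h) two_ne_zero))
      exact pow_le_one₀ (by positivity) (pow_le_one₀ (norm_nonneg _) ht1.le)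
    · refine lt_of_le_of_lt (mul_le_of_le_one_right (by positivity)
        (pow_le_one₀ (norm_nonneg _) hc)) ?_
      rw [← pow_mul]
      exact pow_lt_pow_right_of_lt_one₀ ht0 ht1 (by omega)
  have hdet : ‖(U * !![1, 0; 0, t]).det‖ = ‖t‖ := by
    rw [Matrix.det_mul, norm_mul, hUd, Matrix.det_fin_two_of]
    simp
  have hdet0 : (U * !![1, 0; 0, t]).det ≠ 0 := by
    rw [← norm_pos_iff, hdet]
    exact ht0
  have hmax : maxNorm K e (adjConj (U * !![1, 0; 0, t]) (F, G)).1
      (adjConj (U * !![1, 0; 0, t]) (F, G)).2 ^ 2 < ‖t‖ ^ (e + 1) := by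
    rw [adjConj_mul, ← hQ]
    obtain ⟨i, hi, h1 | h1⟩ := exists_norm_cf_eq_maxNorm e (adjConj !![1, 0; 0, t] Q).1
      (adjConj !![1, 0; 0, t] Q).2
    · rw [h1, (cf_adjConj_diagonal _ _ _ _ _).1, one_pow, one_mul]
      exact key (hQ1 _).1 (ht (Sum.inl ⟨i, by omega⟩)) fun h => (hcf i hi).1 (by omega)
    · rw [h1, (cf_adjConj_diagonal _ _ _ _ _).2, one_pow, one_mul]
      exact key (hQ1 _).2 (ht (Sum.inr ⟨i, by omega⟩)) fun h => (hcf i hi).2 (by omega)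
  refine ⟨Matrix.GeneralLinearGroup.mkOfDetNeZero _ hdet0, ?_⟩
  have hM : ((Matrix.GeneralLinearGroup.mkOfDetNeZero _ hdet0 : GL (Fin 2) K) :
    Matrix (Fin 2) (Fin 2) K) = U * !![1, 0; 0, t] := rfl
  have hpos : 0 < maxNorm K e (adjConj (U * !![1, 0; 0, t]) (F, G)).1
      (adjConj (U * !![1, 0; 0, t]) (F, G)).2 := by
    refine maxNorm_pos he ?_
    rw [bres_adjConj hF hG]
    exact mul_ne_zero (pow_ne_zero _ hdet0) h0
  rw [Rpair_conjPair hF hG h0 _ (by rw [hM]; exact hpos), hM, hdet]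
  have h1 := Real.log_lt_log (by positivity) hmax
  have h2 : (0 : ℝ) < e := by positivity
  have := mul_neg_of_pos_of_neg h2 (sub_neg.2 h1)
  linarith

end ResultantVariation

section Iteration

lemma comp2_map {S T : Type*} [CommRing S] [CommRing T] (φ : S →+* T)
    (F f g : MvPolynomial (Fin 2) S) :
    comp2 (MvPolynomial.map φ F) (MvPolynomial.map φ f) (MvPolynomial.map φ g) =
      MvPolynomial.map φ (comp2 F f g) := by
  unfold comp2
  induction F using MvPolynomial.induction_on with
  | C a => simp
  | add p q hp hq => simp only [map_add, hp, hq]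
  | mul_X p i hp =>
    rw [map_mul, map_mul, hp, map_mul, map_mul]
    congr 1
    fin_cases i <;> simp

lemma pairIter_map {S T : Type*} [CommRing S] [CommRing T] (φ : S →+* T)
    (F G : MvPolynomial (Fin 2) S) (n : ℕ) :
    pairIter (MvPolynomial.map φ F) (MvPolynomial.map φ G) n =
      (MvPolynomial.map φ (pairIter F G n).1, MvPolynomial.map φ (pairIter F G n).2) := by
  induction n with
  | zero => simp [pairIter]
  | succ n ih => simp only [pairIter, ih, comp2_map]

lemma isHomogeneous_pairIter {S : Type*} [CommRing S] {F G : MvPolynomial (Fin 2) S} {d : ℕ}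
    (hF : F.IsHomogeneous d) (hG : G.IsHomogeneous d) (n : ℕ) :
    (pairIter F G n).1.IsHomogeneous (d ^ n) ∧ (pairIter F G n).2.IsHomogeneous (d ^ n) := by
  induction n with
  | zero => exact ⟨isHomogeneous_X _ _, isHomogeneous_X _ _⟩
  | succ n ih =>
    rw [pow_succ']
    exact ⟨isHomogeneous_comp2 hF ih.1 ih.2, isHomogeneous_comp2 hG ih.1 ih.2⟩

variable {K}

lemma norm_coeff_pairIter_le {F G : MvPolynomial (Fin 2) K} (hF : ∀ m, ‖F.coeff m‖ ≤ 1)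
    (hG : ∀ m, ‖G.coeff m‖ ≤ 1) (n : ℕ) (m : Fin 2 →₀ ℕ) :
    ‖(pairIter F G n).1.coeff m‖ ≤ 1 ∧ ‖(pairIter F G n).2.coeff m‖ ≤ 1 := by
  obtain ⟨F, rfl⟩ := exists_map_subtype_eq hF
  obtain ⟨G, rfl⟩ := exists_map_subtype_eq hG
  rw [pairIter_map, coeff_map, coeff_map]
  exact ⟨(coeff m (pairIter F G n).1).2, (coeff m (pairIter F G n).2).2⟩

lemma ordv_bres_pairIter {K : Type} [NontriviallyNormedField K] [IsAlgClosed K]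
    {F G : MvPolynomial (Fin 2) K} {d : ℕ} (hd : 2 ≤ d)
    (hF : F.IsHomogeneous d) (hG : G.IsHomogeneous d) (h0 : bres d F G ≠ 0) (n : ℕ) :
    bres (d ^ n) (pairIter F G n).1 (pairIter F G n).2 ≠ 0 ∧
      ordv K (bres (d ^ n) (pairIter F G n).1 (pairIter F G n).2) =
        ((d : ℝ) ^ n * ((d : ℝ) ^ n - 1) / ((d : ℝ) * ((d : ℝ) - 1))) * ordv K (bres d F G) := by
  induction n with
  | zero =>
    have h1 : bres 1 (X 0) (X 1 : MvPolynomial (Fin 2) K) = 1 := by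
      simpa using bres_linear (1 : Matrix (Fin 2) (Fin 2) K)
    simp [pairIter, h1, ordv]
  | succ n ih =>
    have hh := isHomogeneous_pairIter hF hG n
    have h1 := bres_comp2 hF hG hh.1 hh.2
    have hd' : (2 : ℝ) ≤ d := by exact_mod_cast hd
    rw [← pow_succ'] at h1
    simp only [pairIter]
    rw [h1]
    refine ⟨mul_ne_zero (pow_ne_zero _ h0) (pow_ne_zero _ ih.1), ?_⟩
    have h2 := ih.2
    have hb := norm_ne_zero_iff.2 h0
    have hb' := norm_ne_zero_iff.2 ih.1
    unfold ordv at h2 ⊢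
    rw [norm_mul, norm_pow, norm_pow, Real.log_mul (pow_ne_zero _ hb) (pow_ne_zero _ hb'),
      Real.log_pow, Real.log_pow, neg_add, ← mul_neg, ← mul_neg, h2]
    push_cast
    have h3 : (d : ℝ) - 1 ≠ 0 := by linarith
    have h4 : (d : ℝ) ≠ 0 := by linarith
    field_simp
    ring

lemma bddBelow_Rpair_conjPair [IsAlgClosed K] {e : ℕ} {F G : MvPolynomial (Fin 2) K}
    (hF : F.IsHomogeneous e) (hG : G.IsHomogeneous e) (h0 : bres e F G ≠ 0) :
    BddBelow (Set.range fun M : GL (Fin 2) K =>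
      Rpair K e (conjPair K M F G).1 (conjPair K M F G).2) := by
  refine ⟨0, ?_⟩
  rintro _ ⟨M, rfl⟩
  have hM : (M : Matrix (Fin 2) (Fin 2) K).det ≠ 0 := M.isUnit.map Matrix.detMonoidHom |>.ne_zero
  have hh := isHomogeneous_adjConj (M : Matrix (Fin 2) (Fin 2) K) (P := (F, G)) hF hG
  refine Rpair_nonneg ?_
  rw [conjPair_eq, bres_C_mul _ hh.1 hh.2, bres_adjConj hF hG]
  exact mul_ne_zero (pow_ne_zero _ (inv_ne_zero hM)) (mul_ne_zero (pow_ne_zero _ hM) h0)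

lemma Rmin_le_Rpair [IsAlgClosed K] {e : ℕ} {F G : MvPolynomial (Fin 2) K}
    (hF : F.IsHomogeneous e) (hG : G.IsHomogeneous e) (h0 : bres e F G ≠ 0) :
    Rmin K e F G ≤ Rpair K e F G := by
  have h := ciInf_le (bddBelow_Rpair_conjPair hF hG h0) 1
  have h1 : conjPair K 1 F G = (F, G) := by
    rw [conjPair_eq]
    simp [adjConj_one]
  rw [h1] at h
  exact h

lemma Normalized.maxNorm_eq_one {K : Type} [NontriviallyNormedField K]
    {e : ℕ} {F G : MvPolynomial (Fin 2) K}
    (hF : F.IsHomogeneous e) (hG : G.IsHomogeneous e) (hn : Normalized K F G) :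
    maxNorm K e F G = 1 := by
  obtain ⟨hF1, hG1, m, hm⟩ := hn
  refine le_antisymm (maxNorm_le_iff.2 fun _ _ => ⟨hF1 _, hG1 _⟩) ?_
  obtain hm | hm := hm <;> rw [← hm]
  · exact norm_coeff_le_of_cf hF (maxNorm_nonneg _ _ _)
      (fun i hi => (norm_cf_le_maxNorm hi F G).1) m
  · exact norm_coeff_le_of_cf hG (maxNorm_nonneg _ _ _)
      (fun i hi => (norm_cf_le_maxNorm hi F G).2) m

lemma Semistable.Rmin_eq [IsAlgClosed K] {e : ℕ} (he : e ≠ 0) {F G : MvPolynomial (Fin 2) K}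
    (hF : F.IsHomogeneous e) (hG : G.IsHomogeneous e) (h0 : bres e F G ≠ 0)
    (hn : Normalized K F G) (hs : Semistable K e F G) :
    Rmin K e F G = ordv K (bres e F G) := by
  apply le_antisymm
  · have h := Rmin_le_Rpair hF hG h0
    rwa [Rpair, hn.maxNorm_eq_one hF hG, Real.log_one, mul_zero, add_zero] at h
  · exact le_ciInf (hs.ordv_bres_le_Rpair he hF hG h0 hn)

end Iteration

/-- Suppose `φ` of degree `d ≥ 2` has semistable reduction (in the given
coordinates, with normalized lift `[F,G]`). If for some `n ≥ 1` the minimal resultant satisfies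
`R_{[φⁿ]} = N_n · R_{[φ]}`, then `φⁿ` also has semistable reduction in the same coordinates. -/
theorem iterate_semistable_of_minimal_resultant {K : Type} [NontriviallyNormedField K]
    [IsAlgClosed K] [CompleteSpace K] [IsUltrametricDist K] (d : ℕ) (hd : 2 ≤ d)
    (F G : MvPolynomial (Fin 2) K) (hlift : LiftPair K d F G) (hnorm : Normalized K F G)
    (hss : Semistable K d F G) (n : ℕ) (hn : 1 ≤ n)
    (hmin : Rmin K (d ^ n) (pairIter F G n).1 (pairIter F G n).2 =
      ((d : ℝ) ^ n * ((d : ℝ) ^ n - 1) / ((d : ℝ) * ((d : ℝ) - 1))) * Rmin K d F G) :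
    HasSemistableRed K (d ^ n) (pairIter F G n).1 (pairIter F G n).2 := by
  obtain ⟨hF, hG, hrel⟩ := hlift
  have h0 := bres_ne_zero (by omega) hF hG hrel
  obtain ⟨hn0, hord⟩ := ordv_bres_pairIter hd hF hG h0 n
  obtain ⟨hFn, hGn⟩ := isHomogeneous_pairIter hF hG n
  have hcoeff := norm_coeff_pairIter_le hnorm.1 hnorm.2.1 n
  have he : d ^ n ≠ 0 := pow_ne_zero _ (by omega)
  rw [hss.Rmin_eq (by omega) hF hG h0 hnorm, ← hord] at hmin
  have hnormn : Normalized K (pairIter F G n).1 (pairIter F G n).2 := by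
    refine ⟨fun m => (hcoeff m).1, fun m => (hcoeff m).2, ?_⟩
    have hpos := maxNorm_pos he hn0
    have h1 : 1 ≤ maxNorm K (d ^ n) (pairIter F G n).1 (pairIter F G n).2 := by
      have h2 := Rmin_le_Rpair hFn hGn hn0
      rw [hmin, Rpair, le_add_iff_nonneg_right] at h2
      rw [← Real.log_nonneg_iff hpos]
      exact nonneg_of_mul_nonneg_right h2 (by positivity)
    obtain ⟨i, -, hi | hi⟩ :=
      exists_norm_cf_eq_maxNorm (d ^ n) (pairIter F G n).1 (pairIter F G n).2
    · exact ⟨_, Or.inl (le_antisymm (hcoeff _).1 (h1.trans_eq hi))⟩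
    · exact ⟨_, Or.inr (le_antisymm (hcoeff _).2 (h1.trans_eq hi))⟩
  refine ⟨1, ?_⟩
  rw [Units.val_one, one_smul, one_smul]
  refine ⟨hnormn, ?_⟩
  by_contra hs
  obtain ⟨M, hM⟩ := hnormn.exists_Rpair_lt he hFn hGn hn0 hs
  have h3 := ciInf_le (bddBelow_Rpair_conjPair hFn hGn hn0) M
  rw [← hmin] at hM
  exact absurd h3 (not_le.2 hM)

end
end

section
/- Let q ∈ K satisfy 0 < |q| < 1, and let w ∈ K^× satisfy |q| < |w| < 1. Then the family of terms of Tate's series x(w), namely the terms q^m·w/(1−q^m·w)² + q^m·w⁻¹/(1−q^m·w⁻¹)² − 2q^m/(1−q^m)² for m ≥ 1, is summable in K, so that x(w) = w/(1−w)² + Σ_{m=1}^∞ [ q^m w/(1−q^m w)² + q^m w⁻¹/(1−q^m w⁻¹)² − 2 q^m/(1−q^m)² ] is a well-defined element of K. -/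
noncomputable section

variable (K : Type) [NontriviallyNormedField K] [IsUltrametricDist K]

/-- The sequence `q ^ m * c / (1 - q ^ m * c) ^ 2` tends to `0` when `‖q‖ < 1`. -/
theorem tendsto_pow_mul_div_one_sub_sq {K : Type*} [NormedField K] {q : K}
    (hq : ‖q‖ < 1) (c : K) :
    Filter.Tendsto (fun m : ℕ => q ^ m * c / (1 - q ^ m * c) ^ 2) Filter.atTop (nhds 0) := by
  have h : Filter.Tendsto (fun m : ℕ => q ^ m * c) Filter.atTop (nhds 0) := by
    simpa using (tendsto_pow_atTop_nhds_zero_of_norm_lt_one hq).mul_const c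
  simpa using! h.div ((h.const_sub 1).pow 2) (by simp)

/-- For `0 < |q| < 1` and `w ∈ K^×` with `|q| < |w| < 1`, the family of terms
of Tate's series `x(w)` (for `m ≥ 1`) is summable in `K`, so `x(w)` is well defined. -/
theorem tate_series_summable {K : Type} [NontriviallyNormedField K] [IsAlgClosed K]
    [CompleteSpace K] [IsUltrametricDist K] (q : K) (hq0 : q ≠ 0) (hq1 : ‖q‖ < 1)
    (w : K) (hw0 : w ≠ 0) (hlo : ‖q‖ < ‖w‖) (hhi : ‖w‖ < 1) :
    Summable (fun m : ℕ => tateTerm K q w (m + 1)) := by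
  have h : Filter.Tendsto (tateTerm K q w) Filter.atTop (nhds 0) := by
    have h1 := tendsto_pow_mul_div_one_sub_sq hq1 (1 : K)
    simp only [mul_one] at h1
    simpa [tateTerm] using! ((tendsto_pow_mul_div_one_sub_sq hq1 w).add
      (tendsto_pow_mul_div_one_sub_sq hq1 w⁻¹)).sub (h1.const_mul 2)
  apply NonarchimedeanAddGroup.summable_of_tendsto_cofinite_zero
  rw [Nat.cofinite_eq_atTop]
  exact h.comp (Filter.tendsto_add_atTop_nat 1)

end
end

section
/- Let q ∈ K satisfy 0 < |q| < 1, and let w ∈ K^× satisfy |q|^{1/2} < |w| < 1. Then Tate's series x(w) converges and |x(w)| = |w|. -/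
noncomputable section

variable (K : Type) [NontriviallyNormedField K] [IsUltrametricDist K]

theorem norm_div_one_sub_sq {K : Type} [NontriviallyNormedField K] [IsUltrametricDist K]
    {a : K} (ha : ‖a‖ < 1) : ‖a / (1 - a) ^ 2‖ = ‖a‖ := by
  have h : ‖1 - a‖ = 1 := by
    have hne : ‖(1 : K)‖ ≠ ‖-a‖ := by
      rw [norm_one, norm_neg]
      exact ha.ne'
    rw [sub_eq_add_neg, IsUltrametricDist.norm_add_eq_max_of_norm_ne_norm hne, norm_one,
      norm_neg, max_eq_left ha.le]
  rw [norm_div, norm_pow, h, one_pow, div_one]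

theorem norm_tateTerm_le {K : Type} [NontriviallyNormedField K] [IsUltrametricDist K]
    {q w : K} {m : ℕ} (hw0 : w ≠ 0) (hw1 : ‖w‖ < 1) (h : ‖q ^ m * w⁻¹‖ < 1) :
    ‖tateTerm K q w m‖ ≤ ‖q ^ m * w⁻¹‖ := by
  have hpos : 0 < ‖w‖ := norm_pos_iff.mpr hw0
  have hq : ‖q ^ m‖ ≤ ‖q ^ m * w⁻¹‖ := by
    rw [norm_mul, norm_inv]
    exact le_mul_of_one_le_right (norm_nonneg _) ((one_le_inv₀ hpos).mpr hw1.le)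
  have hqw : ‖q ^ m * w‖ ≤ ‖q ^ m‖ := by
    rw [norm_mul]
    exact mul_le_of_le_one_right (norm_nonneg _) hw1.le
  have h₁ := norm_div_one_sub_sq ((hqw.trans hq).trans_lt h)
  have h₂ := norm_div_one_sub_sq h
  have h₃ := norm_div_one_sub_sq (hq.trans_lt h)
  rw [tateTerm, sub_eq_add_neg _ (2 * _)]
  refine (IsUltrametricDist.norm_add_le_max _ _).trans (max_le ?_ ?_)
  · refine (IsUltrametricDist.norm_add_le_max _ _).trans (max_le ?_ h₂.le)
    exact h₁.trans_le (hqw.trans hq)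
  · rw [norm_neg, two_mul]
    exact (IsUltrametricDist.norm_add_le_max _ _).trans
      (max_le (h₃.trans_le hq) (h₃.trans_le hq))

/-- For `0 < |q| < 1` and `w ∈ K^×` with `|q|^{1/2} < |w| < 1`, Tate's series
`x(w)` converges and `|x(w)| = |w|`. -/
theorem tate_series_norm_outer {K : Type} [NontriviallyNormedField K] [IsAlgClosed K]
    [CompleteSpace K] [IsUltrametricDist K] (q : K) (hq0 : q ≠ 0) (hq1 : ‖q‖ < 1)
    (w : K) (hw0 : w ≠ 0) (hlo : Real.sqrt ‖q‖ < ‖w‖) (hhi : ‖w‖ < 1) :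
    Summable (fun m : ℕ => tateTerm K q w (m + 1)) ∧ ‖xTate K q w‖ = ‖w‖ := by
  have hpos : 0 < ‖w‖ := norm_pos_iff.mpr hw0
  have hqw : ‖q‖ * ‖w‖⁻¹ < ‖w‖ := by
    rw [← div_eq_mul_inv, div_lt_iff₀ hpos, ← sq]
    exact (Real.sqrt_lt' hpos).mp hlo
  have hle (m : ℕ) : ‖q ^ (m + 1) * w⁻¹‖ ≤ ‖q‖ * ‖w‖⁻¹ := by
    rw [norm_mul, norm_inv, norm_pow]
    gcongr
    exact pow_le_of_le_one (norm_nonneg _) hq1.le m.succ_ne_zero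
  have hterm (m : ℕ) : ‖tateTerm K q w (m + 1)‖ ≤ ‖q ^ (m + 1) * w⁻¹‖ :=
    norm_tateTerm_le hw0 hhi ((hle m).trans_lt (hqw.trans hhi))
  have hsum : Summable fun m : ℕ => ‖q ^ (m + 1) * w⁻¹‖ := by
    simp only [norm_mul, norm_pow]
    exact ((summable_nat_add_iff 1).mpr
      (summable_geometric_of_lt_one (norm_nonneg q) hq1)).mul_right _
  refine ⟨.of_norm_bounded hsum hterm, ?_⟩
  have htail : ‖∑' m : ℕ, tateTerm K q w (m + 1)‖ < ‖w‖ :=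
    (IsUltrametricDist.norm_tsum_le_of_forall_le fun m => (hterm m).trans (hle m)).trans_lt hqw
  have hhead := norm_div_one_sub_sq hhi
  rw [xTate, IsUltrametricDist.norm_add_eq_max_of_norm_ne_norm (hhead ▸ htail.ne'), hhead,
    max_eq_left htail.le]

end
end
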